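/- There exists an absolute constant c > 0 such that for any β ≥ 1, any finite domain Λ ⊂ ℤ², any site v ∈ Λ and any integer h ≥ 0: (1/2)·e^{−4βh} ≤ π̂_Λ^0( η_v ≥ h ) ≤ c·e^{−4βh}, where π̂_Λ^0 is the SOS measure on Λ without floor and without ceiling and with zero boundary conditions. -/

import Mathlib

open scoped Classical
open Filter

noncomputable section

namespace SOSPaper

/-- Sites of the lattice `ℤ²`. -/
abbrev Site : Type := ℤ × ℤ

/-- Height configurations on `ℤ²`. -/
abbrev Config : Type := Site → ℤ

/-- Nearest-neighbour adjacency on `ℤ²`. -/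
def SiteAdj (x y : Site) : Prop := (x.1 - y.1).natAbs + (x.2 - y.2).natAbs = 1

/-- The four nearest neighbours of a site. -/
def nbrs (x : Site) : Finset Site :=
  {(x.1 + 1, x.2), (x.1 - 1, x.2), (x.1, x.2 + 1), (x.1, x.2 - 1)}

/-- The SOS Hamiltonian on `Λ` with boundary condition `ξ`:
`H_Λ^ξ(η) = (1/2) Σ_{x,y∈Λ adjacent} |η_x-η_y| + Σ_{x∈Λ, y∉Λ adjacent} |η_x-ξ_y|`. -/
def sosH (Λ : Finset Site) (ξ : Config) (η : Config) : ℝ :=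
  (1 / 2) * ∑ x ∈ Λ, ∑ y ∈ (nbrs x).filter (fun y => y ∈ Λ), ((|η x - η y| : ℤ) : ℝ)
    + ∑ x ∈ Λ, ∑ y ∈ (nbrs x).filter (fun y => y ∉ Λ), ((|η x - ξ y| : ℤ) : ℝ)

/-- Extension of `g : Λ → ℤ` by the boundary condition `ξ` off `Λ`. -/
def extendC (Λ : Finset Site) (ξ : Config) (g : {x // x ∈ Λ} → ℤ) : Config :=
  fun x => if h : x ∈ Λ then g ⟨x, h⟩ else ξ x

/-- Gibbs weight `exp(-β·H_Λ^ξ(η) + F(η))`, subject to the single-site constraint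
`η_x ∈ K` for all `x ∈ Λ` (floor/ceiling constraints); `F` is an extra external field
(`F = 0` for the plain SOS model). -/
def gWeight (β : ℝ) (Λ : Finset Site) (ξ : Config) (K : Set ℤ) (F : Config → ℝ)
    (η : Config) : ℝ :=
  if ∀ x ∈ Λ, η x ∈ K then Real.exp (-β * sosH Λ ξ η + F η) else 0

/-- The Gibbs probability of a set `A` of configurations: normalized sum of Gibbs
weights over all configurations agreeing with `ξ` off `Λ`. -/
def gProb (β : ℝ) (Λ : Finset Site) (ξ : Config) (K : Set ℤ) (F : Config → ℝ)
    (A : Set Config) : ℝ :=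
  (∑' g : {x // x ∈ Λ} → ℤ, Set.indicator A (gWeight β Λ ξ K F) (extendC Λ ξ g))
    / ∑' g : {x // x ∈ Λ} → ℤ, gWeight β Λ ξ K F (extendC Λ ξ g)

/-- The box `Λ_L = {1,…,L}²`. -/
def box (L : ℕ) : Finset Site := Finset.Icc ((1 : ℤ), (1 : ℤ)) ((L : ℤ), (L : ℤ))

/-- The equilibrium height `H(L) = ⌊log L / (4β)⌋`. -/
def eqHt (β : ℝ) (L : ℕ) : ℤ := ⌊Real.log L / (4 * β)⌋

/-! ### Directions, turn words and the counting certificate -/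

def vx (d : Fin 4) : ℤ := match d with | 0 => 1 | 1 => 0 | 2 => -1 | 3 => 0
def vy (d : Fin 4) : ℤ := match d with | 0 => 0 | 1 => 1 | 2 => 0 | 3 => -1
def dv (d : Fin 4) : Site := (vx d, vy d)
def vsum (l : List (Fin 4)) : Site := (l.map dv).sum

inductive Tr where
  | l : ℕ → Tr
  | n : Tr → Tr → Tr → Tr

def Tr.mx : Tr → ℕ
  | .l k => k
  | .n a b c => max a.mx (max b.mx c.mx)

def Tr.dep : Tr → ℕ
  | .l _ => 0
  | .n a b c => max a.dep (max b.dep c.dep) + 1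

def Tr.look : Tr → List (Fin 4) → ℕ
  | .l k, _ => k
  | .n a b c, [] => max a.mx (max b.mx c.mx)
  | .n a b c, t :: ts => match t with
    | 0 => a.look ts
    | 1 => b.look ts
    | 2 => 0
    | 3 => c.look ts

def hit : List (Fin 4) → Fin 4 → ℤ → ℤ → Bool
  | [], _, _, _ => false
  | t :: ts, h, x, y =>
    ((x + vx (h - t)) == 0 && (y + vy (h - t)) == 0) ||
      hit ts (h - t) (x + vx (h - t)) (y + vy (h - t))

def clash (h : Fin 4) (w : List (Fin 4)) : Bool := hit w h (vx h) (vy h)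

def si : List (Fin 4) → Bool
  | [] => false
  | t :: ts => clash 0 (t :: ts) || si ts

def fw (T : Tr) (w : List (Fin 4)) : ℕ := match clash 0 w with
  | true => 0
  | false => T.look w

def chk (T : Tr) : Tr → List (Fin 4) → Bool
  | .l k, u => si u || (Nat.ble 1 k &&
      Nat.ble (500 * (fw T (0 :: u) + fw T (1 :: u) + fw T (3 :: u))) (1359 * k))
  | .n a b c, u => chk T a (u ++ [0]) && (chk T b (u ++ [1]) && chk T c (u ++ [3]))

section
open Tr
def cert : Tr :=
n (n (n (n (n (l 3000) (n (l 2995) (n (n (n (n (l 2053) (l 0) (l 2995)) (l 0) (l 2995)) (l 0) (l 2995)) (l 0)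
  (l 2995)) (l 2995)) (n (l 2995) (l 2995) (n (n (n (n (l 2053) (l 2995) (l 0)) (l 2995) (l 0)) (l 2995) (l 0))
  (l 2995) (l 0)))) (n (n (l 2961) (n (n (n (l 2481) (l 2793) (l 2842)) (l 2911) (l 2961)) (n (l 0) (l 0) (n (n
  (l 2053) (l 0) (l 2961)) (l 0) (l 2961))) (l 2961)) (l 2961)) (n (n (n (n (n (l 1706) (l 951) (l 1706)) (l 0)
  (l 2053)) (l 0) (n (l 2797) (l 2432) (l 2797))) (l 0) (n (l 2921) (n (l 2432) (l 2797) (l 2797)) (l 2921))) (l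
  0) (n (l 2964) (n (n (l 2475) (l 2797) (l 2841)) (l 2921) (l 2964)) (l 2964))) (l 2986)) (n (n (l 2961) (l
  2961) (n (n (n (l 2481) (l 2842) (l 2793)) (l 2961) (l 2911)) (l 2961) (n (l 0) (n (n (l 2053) (l 2961) (l 0))
  (l 2961) (l 0)) (l 0)))) (l 2986) (n (n (n (n (n (l 1706) (l 1706) (l 951)) (l 2053) (l 0)) (n (l 2797) (l
  2797) (l 2432)) (l 0)) (n (l 2921) (l 2921) (n (l 2432) (l 2797) (l 2797))) (l 0)) (n (l 2964) (l 2964) (n (n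
  (l 2475) (l 2840) (l 2797)) (l 2964) (l 2921))) (l 0)))) (n (n (n (l 2870) (n (n (l 2650) (n (l 2696) (l 2768)
  (l 2502)) (l 2782)) (n (l 2847) (l 0) (n (l 2536) (l 2741) (l 2847))) (l 2870)) (l 2870)) (n (n (n (n (l 2121)
  (n (l 1208) (l 1877) (l 2121)) (l 2121)) (n (l 0) (l 1992) (n (l 1992) (l 964) (l 1992))) (l 2386)) (n (l 0)
  (l 2680) (n (n (l 2035) (l 964) (l 2035)) (l 0) (l 2035))) (n (l 2698) (l 2564) (l 2698))) (n (l 0) (l 0) (n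
  (n (n (l 1719) (l 964) (l 1719)) (l 0) (l 2053)) (l 0) (n (l 2751) (l 2430) (l 0)))) (n (l 2823) (n (l 2603)
  (l 2725) (l 2728)) (l 2823))) (l 2909)) (n (n (n (n (n (l 1545) (l 1267) (l 1545)) (n (l 586) (l 0) (l 917))
  (l 1672)) (l 0) (n (l 1993) (n (l 1859) (n (l 964) (l 0) (l 1859)) (l 1859)) (l 1993))) (l 0) (n (n (l 2693)
  (l 2551) (l 2693)) (n (n (l 2103) (n (l 1208) (l 1859) (l 2103)) (l 2103)) (n (l 0) (l 0) (n (l 1993) (l 964)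
  (l 1993))) (l 2371)) (l 2693))) (l 0) (n (n (l 2815) (n (l 2688) (l 2782) (l 2815)) (l 2815)) (n (n (n (l
  2119) (n (l 1208) (l 1875) (l 2119)) (l 2119)) (n (l 0) (l 1993) (n (l 1993) (l 964) (l 1993))) (l 2387)) (n
  (l 0) (l 0) (n (n (l 2039) (l 964) (l 2039)) (l 0) (l 2039))) (n (l 2703) (l 2567) (l 2703))) (l 2846))) (n (l
  2965) (n (l 2945) (n (n (n (l 2589) (l 2794) (l 2945)) (l 2945) (l 2945)) (l 0) (l 2945)) (l 2945)) (n (n (l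
  2949) (l 2949) (n (n (n (l 2005) (l 2949) (l 0)) (l 2949) (l 0)) (l 2949) (l 0))) (l 2965) (l 0)))) (n (n (n
  (l 2870) (l 2870) (n (n (l 2650) (l 2782) (n (l 2696) (l 2502) (l 2768))) (l 2870) (n (l 2847) (n (l 2536) (l
  2847) (l 2741)) (l 0)))) (l 2909) (n (n (n (n (l 2122) (l 2122) (n (l 1208) (l 2122) (l 1877))) (l 2386) (n (l
  0) (n (l 1992) (l 1992) (l 964)) (l 1992))) (n (l 2698) (l 2698) (l 2564)) (n (l 0) (n (n (l 2035) (l 2035) (l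
  964)) (l 2035) (l 0)) (l 2680))) (n (l 2823) (l 2823) (n (l 2603) (l 2728) (l 2725))) (n (l 0) (n (n (n (l
  1719) (l 1719) (l 964)) (l 2054) (l 0)) (n (l 2751) (l 0) (l 2430)) (l 0)) (l 0)))) (n (l 2965) (n (n (l 2949)
  (n (n (n (l 2005) (l 0) (l 2949)) (l 0) (l 2949)) (l 0) (l 2949)) (l 2949)) (l 0) (l 2965)) (n (l 2945) (l
  2945) (n (n (n (l 2589) (l 2945) (l 2794)) (l 2945) (l 2945)) (l 2945) (l 0)))) (n (n (n (n (n (l 1545) (l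
  1545) (l 1267)) (l 1673) (n (l 586) (l 917) (l 0))) (n (l 1993) (l 1993) (n (l 1859) (l 1859) (n (l 964) (l
  1859) (l 0)))) (l 0)) (n (n (l 2693) (l 2693) (l 2551)) (l 2693) (n (n (l 2103) (l 2103) (n (l 1208) (l 2103)
  (l 1859))) (l 2371) (n (l 0) (n (l 1993) (l 1993) (l 964)) (l 0)))) (l 0)) (n (n (l 2815) (l 2815) (n (l 2636)
  (l 2763) (l 2730))) (l 2846) (n (n (n (l 2119) (l 2119) (n (l 1208) (l 2119) (l 1875))) (l 2387) (n (l 0) (n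
  (l 1993) (l 1993) (l 964)) (l 1993))) (n (l 2703) (l 2703) (l 2567)) (n (l 0) (n (n (l 2039) (l 2039) (l 964))
  (l 2039) (l 0)) (l 0)))) (l 0)))) (n (n (n (n (l 2737) (n (l 2664) (l 2698) (l 2710)) (l 2737)) (n (n (n (l
  2380) (n (n (l 1091) (l 1965) (l 2066)) (l 2297) (l 2380)) (l 2380)) (n (n (l 0) (l 1981) (n (l 1981) (l 989)
  (l 1981))) (l 2370) (n (l 2272) (n (l 1007) (l 1910) (l 1928)) (l 2272))) (l 2526)) (n (n (l 0) (l 0) (n (n (l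
  2037) (l 989) (l 2037)) (l 0) (l 2037))) (l 0) (n (n (l 2166) (n (l 1233) (l 1922) (l 2166)) (l 2166)) (n (l
  0) (l 1998) (n (l 1998) (l 989) (l 1998))) (l 2400))) (n (l 2674) (l 2623) (l 2674))) (l 2763)) (n (n (n (n (l
  1948) (n (l 1515) (l 1761) (l 1851)) (l 1948)) (n (n (l 615) (l 0) (l 971)) (l 1704) (n (l 1704) (l 1326) (l
  1704))) (l 2093)) (n (l 0) (l 1968) (n (n (l 1731) (l 1337) (l 1731)) (n (l 615) (l 0) (l 982)) (l 1731))) (n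
  (l 2327) (n (l 2227) (n (n (l 1284) (l 1933) (l 2227)) (l 0) (l 2227)) (l 2227)) (l 2327))) (n (l 0) (l 0) (n
  (n (n (l 1578) (l 1300) (l 1578)) (n (l 615) (l 0) (l 946)) (l 1701)) (l 0) (n (l 2002) (n (l 1883) (n (l 989)
  (l 0) (l 1883)) (l 1883)) (l 0)))) (n (n (l 2625) (l 2572) (l 2625)) (n (n (l 2342) (n (n (l 1384) (l 1947) (l
  2342)) (l 2342) (l 2342)) (l 2342)) (n (n (l 0) (l 1992) (n (l 1992) (l 989) (l 1992))) (l 0) (n (l 2337) (n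
  (l 989) (l 1992) (l 1992)) (l 2337))) (l 2488)) (l 2625))) (n (l 2829) (n (l 2809) (n (n (l 2639) (l 2727) (l
  2766)) (l 0) (l 2809)) (l 2809)) (n (n (n (l 2782) (l 2782) (n (n (l 1843) (l 2782) (l 0)) (l 2782) (l 0))) (l
  2829) (l 0)) (l 2829) (l 0)))) (n (n (n (n (n (l 1473) (l 1370) (l 1473)) (n (l 992) (l 871) (l 1242)) (l
  1520)) (n (n (l 481) (l 1) (l 609)) (l 0) (n (l 883) (l 744) (l 883))) (n (l 1673) (n (l 1623) (n (l 1294) (l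
  0) (l 1623)) (l 1623)) (l 1673))) (l 0) (n (n (l 1974) (n (l 1921) (n (n (l 983) (l 0) (l 1921)) (l 0) (l
  1921)) (l 1921)) (l 1974)) (n (n (l 1738) (n (l 1408) (l 1648) (l 1738)) (l 1738)) (n (n (l 615) (l 0) (l
  964)) (l 0) (n (l 1697) (l 1318) (l 1697))) (l 1837)) (l 1974))) (l 0) (n (n (n (l 2592) (l 2555) (l 2592)) (n
  (n (l 2369) (n (n (l 1379) (l 1978) (l 2369)) (l 2369) (l 2369)) (l 2369)) (n (n (l 0) (l 0) (n (l 2013) (l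
  989) (l 2013))) (l 0) (n (l 2354) (n (l 989) (l 2013) (l 2013)) (l 2354))) (l 2506)) (l 2609)) (n (n (n (l
  1940) (n (l 1605) (l 1850) (l 1940)) (l 1940)) (n (n (l 615) (l 0) (l 964)) (l 1697) (n (l 1697) (l 1318) (l
  1697))) (l 2087)) (n (l 0) (l 0) (n (n (l 1733) (l 1337) (l 1733)) (n (l 615) (l 0) (l 983)) (l 1733))) (n (l
  2323) (n (l 2222) (n (n (l 1278) (l 1927) (l 2222)) (l 0) (l 2222)) (l 2222)) (l 2323))) (n (l 2673) (n (l
  2657) (n (l 2536) (l 0) (l 2657)) (l 2657)) (l 0)))) (n (n (l 2921) (n (l 2906) (n (n (n (l 2558) (l 2792) (l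
  2906)) (l 0) (l 2906)) (l 0) (l 2906)) (l 2906)) (n (n (l 2904) (l 2904) (n (n (n (l 1946) (l 2904) (l 0)) (l
  2904) (l 0)) (l 2904) (l 2904))) (l 2921) (n (l 0) (n (l 2916) (l 2916) (n (n (l 1946) (l 2916) (l 0)) (l
  2916) (l 0))) (l 0)))) (n (n (l 2847) (n (n (l 2675) (l 2751) (l 2805)) (n (l 0) (l 0) (n (l 2518) (l 2756) (l
  2835))) (l 2847)) (l 2847)) (n (n (n (n (l 2178) (n (l 1225) (l 1933) (l 2178)) (l 2178)) (n (l 0) (l 2009) (n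
  (l 2009) (l 980) (l 2009))) (l 2439)) (n (l 0) (l 0) (n (n (l 2064) (l 980) (l 2064)) (l 0) (l 2064))) (n (l
  2709) (l 2573) (l 2709))) (l 0) (n (l 2841) (n (l 2609) (l 2745) (l 2745)) (l 2841))) (l 2880)) (n (n (n (l
  2818) (l 2818) (n (n (l 2461) (l 2818) (l 2674)) (l 2818) (l 2818))) (l 2870) (n (n (n (n (l 1592) (l 1592) (l
  854)) (l 1940) (l 0)) (n (l 2686) (l 2686) (l 2316)) (l 0)) (n (l 2811) (l 2811) (n (l 2316) (l 2686) (l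
  2686))) (l 0))) (n (l 2918) (l 2918) (n (l 2900) (l 2900) (n (n (n (l 1946) (l 2900) (l 0)) (l 2900) (l 0)) (l
  2900) (l 0)))) (l 0)))) (n (n (n (n (l 2736) (l 2736) (n (l 2663) (l 2709) (l 2697))) (l 2762) (n (n (n (l
  2380) (l 2380) (n (n (l 1090) (l 2066) (l 1964)) (l 2380) (l 2297))) (l 2525) (n (n (l 0) (n (l 1981) (l 1981)
  (l 989)) (l 1981)) (n (l 2271) (l 2271) (n (l 1007) (l 1928) (l 1910))) (l 2369))) (n (l 2673) (l 2673) (l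
  2622)) (n (n (l 0) (n (n (l 2037) (l 2037) (l 989)) (l 2037) (l 0)) (l 0)) (n (n (l 2166) (l 2166) (n (l 1233)
  (l 2166) (l 1922))) (l 2399) (n (l 0) (n (l 1998) (l 1998) (l 989)) (l 1998))) (l 0)))) (n (l 2828) (n (n (n
  (l 2781) (n (n (l 1842) (l 0) (l 2781)) (l 0) (l 2781)) (l 2781)) (l 0) (l 2828)) (l 0) (l 2828)) (n (l 2808)
  (l 2808) (n (n (l 2638) (l 2765) (l 2726)) (l 2808) (l 0)))) (n (n (n (n (l 1948) (l 1948) (n (l 1515) (l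
  1851) (l 1761))) (l 2093) (n (n (l 615) (l 971) (l 0)) (n (l 1704) (l 1704) (l 1326)) (l 1704))) (n (l 2327)
  (l 2327) (n (l 2227) (l 2227) (n (n (l 1283) (l 2227) (l 1933)) (l 2227) (l 0)))) (n (l 0) (n (n (l 1731) (l
  1731) (l 1336)) (l 1731) (n (l 615) (l 982) (l 0))) (l 1968))) (n (n (l 2625) (l 2625) (l 2571)) (l 2625) (n
  (n (l 2342) (l 2342) (n (n (l 1072) (l 2030) (l 1947)) (l 2342) (l 2259))) (l 2488) (n (n (l 0) (n (l 1992) (l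
  1992) (l 989)) (l 1992)) (n (l 2337) (l 2337) (n (l 989) (l 1992) (l 1992))) (l 0)))) (n (l 0) (n (n (n (l
  1579) (l 1579) (l 1300)) (l 1702) (n (l 615) (l 946) (l 0))) (n (l 2001) (l 0) (n (l 1883) (l 1883) (n (l 989)
  (l 1883) (l 0)))) (l 0)) (l 0)))) (n (n (l 2920) (n (n (l 2904) (n (n (n (l 1946) (l 0) (l 2904)) (l 0) (l
  2904)) (l 2904) (l 2904)) (l 2904)) (n (l 0) (l 0) (n (l 2916) (n (n (l 1946) (l 0) (l 2916)) (l 0) (l 2916))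
  (l 2916))) (l 2920)) (n (l 2906) (l 2906) (n (n (n (l 2557) (l 2906) (l 2792)) (l 2906) (l 0)) (l 2906) (l
  0)))) (n (n (n (l 2818) (n (n (l 2460) (l 2674) (l 2818)) (l 2818) (l 2818)) (l 2818)) (n (n (n (n (l 1592) (l
  854) (l 1592)) (l 0) (l 1940)) (l 0) (n (l 2685) (l 2316) (l 2685))) (l 0) (n (l 2811) (n (l 2316) (l 2685) (l
  2685)) (l 2811))) (l 2870)) (l 0) (n (l 2918) (n (l 2899) (n (n (n (l 1946) (l 0) (l 2899)) (l 0) (l 2899)) (l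
  0) (l 2899)) (l 2899)) (l 2918))) (n (n (l 2847) (l 2847) (n (n (l 2632) (l 2762) (l 2751)) (l 2847) (n (l 0)
  (n (l 2518) (l 2824) (l 2744)) (l 0)))) (l 2880) (n (n (n (n (l 2178) (l 2178) (n (l 1225) (l 2178) (l 1933)))
  (l 2438) (n (l 0) (n (l 2008) (l 2008) (l 980)) (l 2008))) (n (l 2708) (l 2708) (l 2572)) (n (l 0) (n (n (l
  2064) (l 2064) (l 980)) (l 2064) (l 0)) (l 0))) (n (l 2841) (l 2841) (n (l 2609) (l 2745) (l 2745))) (l 0))))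
  (n (n (n (n (n (l 1473) (l 1473) (l 1371)) (l 1520) (n (l 993) (l 1242) (l 871))) (n (l 1673) (l 1673) (n (l
  1624) (l 1624) (n (l 1294) (l 1624) (l 0)))) (n (n (l 481) (l 609) (l 1)) (n (l 883) (l 883) (l 744)) (l 0)))
  (n (n (l 1973) (l 1973) (n (l 1921) (l 1921) (n (n (l 982) (l 1921) (l 0)) (l 1921) (l 0)))) (l 1973) (n (n (l
  1738) (l 1738) (n (l 1409) (l 1738) (l 1648))) (l 1837) (n (n (l 615) (l 964) (l 0)) (n (l 1698) (l 1698) (l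
  1319)) (l 0)))) (l 0)) (n (n (n (l 2592) (l 2592) (l 2554)) (l 2609) (n (n (l 2350) (l 2350) (n (n (l 1379) (l
  2350) (l 1959)) (l 2350) (l 2350))) (l 2487) (n (n (l 0) (n (l 1993) (l 1993) (l 989)) (l 0)) (n (l 2335) (l
  2335) (n (l 989) (l 1993) (l 1993))) (l 0)))) (n (l 2672) (l 0) (n (l 2656) (l 2656) (n (l 2535) (l 2656) (l
  0)))) (n (n (n (l 1940) (l 1940) (n (l 1605) (l 1940) (l 1850))) (l 2087) (n (n (l 615) (l 964) (l 0)) (n (l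
  1698) (l 1698) (l 1319)) (l 1698))) (n (l 2323) (l 2323) (n (l 2222) (l 2222) (n (n (l 1278) (l 2222) (l
  1927)) (l 2222) (l 0)))) (n (l 0) (n (n (l 1733) (l 1733) (l 1337)) (l 1733) (n (l 615) (l 982) (l 0))) (l
  0)))) (l 0)))) (n (n (n (n (n (l 2575) (l 2561) (l 2575)) (n (n (l 2466) (n (n (n (l 1163) (l 2009) (l 2144))
  (l 2332) (l 2466)) (l 2466) (l 2466)) (l 2466)) (n (n (n (l 0) (l 0) (n (l 2021) (l 1029) (l 2021))) (l 0) (n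
  (l 2357) (n (l 1029) (l 2021) (l 2021)) (l 2357))) (l 0) (n (l 2475) (n (n (l 1147) (l 2021) (l 2139)) (l
  2357) (l 2475)) (l 2475))) (l 2534)) (l 2582)) (n (n (n (l 2218) (n (n (l 1621) (n (l 1745) (l 1943) (l 1220))
  (l 1980)) (n (l 2156) (l 0) (n (l 1310) (l 1868) (l 2156))) (l 2218)) (l 2218)) (n (n (n (l 665) (l 0) (l
  1023)) (l 1752) (n (l 1752) (l 1386) (l 1752))) (n (l 0) (l 0) (n (l 0) (l 0) (n (l 1895) (l 1022) (l 0)))) (n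
  (l 2092) (n (l 1493) (l 1825) (l 1832)) (l 2092))) (l 2325)) (n (n (l 0) (l 0) (n (n (l 1777) (l 1391) (l
  1777)) (n (l 665) (l 0) (l 1027)) (l 1777))) (l 0) (n (n (l 2065) (n (l 1721) (l 1975) (l 2065)) (l 2065)) (n
  (n (l 665) (l 0) (l 1027)) (l 1762) (n (l 1762) (l 1391) (l 1762))) (l 2151))) (n (l 2460) (n (l 2403) (n (n
  (n (l 1438) (l 1994) (l 2403)) (l 2403) (l 2403)) (l 0) (l 2403)) (l 2403)) (l 2460))) (n (l 2617) (n (l 2611)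
  (n (l 2566) (l 0) (l 2611)) (l 2611)) (n (n (n (n (l 2490) (l 2490) (n (l 1591) (l 2490) (l 0))) (l 2617) (l
  0)) (l 2617) (l 0)) (l 2617) (l 0)))) (n (n (n (n (l 1878) (n (l 1682) (l 1772) (l 1805)) (l 1878)) (n (n (n
  (l 1130) (n (l 276) (l 903) (l 1130)) (l 1130)) (n (l 0) (l 983) (n (l 983) (l 50) (l 983))) (l 1394)) (n (l
  1615) (l 0) (n (l 663) (l 0) (l 988))) (n (l 1709) (l 1569) (l 1709))) (l 1949)) (n (n (n (n (l 534) (l 270)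
  (l 534)) (l 1) (l 663)) (l 0) (n (l 938) (l 801) (l 938))) (l 1709) (n (n (l 1621) (l 1476) (l 1621)) (n (l
  1073) (n (l 0) (l 0) (n (l 938) (l 1) (l 938))) (l 1346)) (l 1621))) (n (l 2098) (n (l 2042) (n (n (l 1580) (l
  1818) (l 1927)) (l 0) (l 2042)) (l 2042)) (l 2098))) (n (l 0) (l 0) (n (n (n (l 1542) (l 1439) (l 1542)) (n (l
  1061) (n (l 0) (l 0) (n (l 928) (l 1) (l 928))) (l 1309)) (l 1587)) (n (n (l 533) (l 1) (l 665)) (l 0) (n (l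
  940) (l 802) (l 940))) (n (l 1729) (n (l 1686) (n (l 1357) (l 0) (l 1686)) (l 1686)) (l 0)))) (n (n (l 2320)
  (n (l 2280) (n (n (n (l 1333) (l 1971) (l 2280)) (l 0) (l 2280)) (l 0) (l 2280)) (l 2280)) (l 2320)) (n (n (l
  2128) (n (n (l 1659) (l 1867) (l 2012)) (n (l 0) (l 0) (n (l 1234) (l 1880) (l 2096))) (l 2128)) (l 2128)) (n
  (n (n (l 666) (l 0) (l 1018)) (l 1751) (n (l 1751) (l 1382) (l 1751))) (l 0) (n (l 2112) (n (l 1482) (l 1851)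
  (l 1851)) (l 2112))) (l 2218)) (l 2320))) (n (n (l 2686) (n (l 2679) (n (n (l 2551) (l 0) (l 2679)) (l 0) (l
  2679)) (l 2679)) (n (n (n (l 2637) (l 2637) (n (n (l 1670) (l 2637) (l 0)) (l 2637) (l 2637))) (l 2686) (n (l
  0) (n (l 2666) (l 2666) (n (l 1670) (l 2666) (l 0))) (l 2666))) (l 2686) (n (l 0) (n (n (l 2568) (l 2568) (n
  (l 1670) (l 2568) (l 0))) (l 2686) (l 0)) (l 0)))) (n (n (l 2648) (n (l 2603) (l 2636) (l 2648)) (l 2648)) (n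
  (n (n (l 2386) (n (n (l 1415) (l 1994) (l 2386)) (l 2386) (l 2386)) (l 2386)) (n (n (l 0) (l 0) (n (l 2027) (l
  1023) (l 2027))) (l 0) (n (l 2368) (n (l 1023) (l 2027) (l 2027)) (l 2368))) (l 2528)) (l 0) (n (l 2643) (l
  2591) (l 2643))) (l 2661)) (n (n (n (n (l 2456) (l 2456) (n (l 2110) (l 2456) (l 2366))) (l 2551) (n (n (l
  1307) (l 1653) (l 0)) (n (l 2398) (l 2398) (l 2019)) (l 0))) (n (l 2668) (l 2668) (n (l 2618) (l 2618) (n (n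
  (l 1670) (l 2618) (l 0)) (l 2618) (l 0)))) (l 0)) (n (l 2685) (l 2685) (n (n (l 2618) (l 2618) (n (n (l 1670)
  (l 2618) (l 0)) (l 2618) (l 2618))) (l 2668) (n (l 0) (n (l 2668) (l 2668) (n (l 1670) (l 2668) (l 0))) (l
  0)))) (l 0)))) (n (n (n (n (n (l 1466) (l 1429) (l 1466)) (n (n (l 1242) (n (n (l 366) (l 877) (l 1242)) (l
  1242) (l 1242)) (l 1242)) (n (n (l 0) (l 0) (n (l 912) (l 1) (l 912))) (l 0) (n (l 1232) (n (l 321) (l 912) (l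
  1232)) (l 1232))) (l 1381)) (l 1484)) (n (n (n (l 869) (n (l 536) (l 782) (l 869)) (l 869)) (n (l 1) (l 634)
  (n (l 634) (l 272) (l 634))) (l 1013)) (n (l 0) (l 0) (n (l 654) (l 1) (l 654))) (n (l 1214) (l 1111) (l
  1214))) (n (l 1559) (n (l 1541) (n (l 1420) (l 0) (l 1541)) (l 1541)) (l 1559))) (n (n (n (n (l 471) (l 371)
  (l 471)) (n (l 134) (l 1) (l 255)) (l 518)) (l 1) (n (l 636) (n (l 586) (n (l 272) (l 0) (l 586)) (l 586)) (l
  636))) (l 0) (n (n (l 893) (l 838) (l 893)) (n (n (l 673) (n (l 359) (l 586) (l 673)) (l 673)) (n (l 1) (l 0)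
  (n (l 636) (l 272) (l 636))) (l 773)) (l 893))) (n (n (l 1707) (n (l 1687) (n (n (l 1342) (l 0) (l 1687)) (l
  0) (l 1687)) (l 1687)) (l 1707)) (n (n (l 1606) (n (l 1485) (l 1573) (l 1606)) (l 1606)) (n (n (l 1064) (n (l
  0) (l 0) (n (l 927) (l 1) (l 927))) (l 1321)) (l 0) (n (l 1591) (l 1452) (l 1591))) (l 1642)) (l 1707))) (l 0)
  (n (n (n (l 1982) (n (l 1968) (n (n (n (l 1028) (l 0) (l 1968)) (l 0) (l 1968)) (l 0) (l 1968)) (l 1968)) (l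
  1982)) (n (n (l 1892) (n (n (l 1528) (l 1748) (l 1892)) (n (l 0) (l 0) (n (l 1020) (l 0) (l 1892))) (l 1892))
  (l 1892)) (n (n (n (l 668) (l 0) (l 1020)) (l 0) (n (l 1761) (l 1384) (l 1761))) (l 0) (n (l 1887) (n (l 1384)
  (l 1761) (l 1761)) (l 1887))) (l 1943)) (l 1988)) (n (n (n (l 1698) (n (l 1574) (l 1665) (l 1698)) (l 1698))
  (n (n (l 1080) (l 932) (l 1338)) (n (l 0) (l 0) (n (l 665) (l 0) (l 984))) (n (l 1608) (l 1469) (l 1608))) (l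
  1752)) (n (n (n (l 536) (l 1) (l 665)) (l 0) (n (l 939) (l 802) (l 939))) (l 0) (n (n (l 1624) (l 1478) (l
  1624)) (n (l 1028) (n (l 0) (l 0) (n (l 939) (l 1) (l 939))) (l 1301)) (l 1624))) (n (l 1859) (n (l 1822) (n
  (n (l 1474) (l 1713) (l 1822)) (l 0) (l 1822)) (l 1822)) (l 1859))) (n (n (l 2005) (l 2005) (n (n (n (l 1879)
  (l 1879) (n (l 984) (l 1879) (l 0))) (l 2005) (l 0)) (l 2005) (l 0))) (n (l 2005) (n (n (l 1961) (n (n (l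
  1028) (l 0) (l 1961)) (l 0) (l 1961)) (l 1961)) (l 0) (l 2005)) (l 2005)) (l 0)))) (n (n (n (l 2793) (n (l
  2788) (n (n (n (l 2442) (l 0) (l 2788)) (l 0) (l 2788)) (l 0) (l 2788)) (l 2788)) (n (n (l 2777) (l 2777) (n
  (n (n (l 1805) (l 2777) (l 0)) (l 2777) (l 2777)) (l 2777) (l 2777))) (l 2793) (n (n (l 0) (n (l 2789) (l
  2789) (n (l 1805) (l 2789) (l 0))) (l 0)) (n (l 2789) (l 2789) (n (n (l 1805) (l 2789) (l 0)) (l 2789) (l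
  2789))) (l 0)))) (n (n (l 2762) (n (n (l 2628) (l 2710) (l 2762)) (n (l 0) (l 0) (n (l 2442) (l 0) (l 2762)))
  (l 2762)) (l 2762)) (n (n (n (n (l 2183) (n (l 1242) (l 1938) (l 2183)) (l 2183)) (n (l 0) (l 0) (n (l 2024)
  (l 997) (l 2024))) (l 2442)) (l 0) (n (l 2714) (l 2575) (l 2714))) (l 0) (n (l 2760) (n (l 2575) (l 2714) (l
  2714)) (l 2760))) (l 2781)) (n (n (n (l 2677) (l 2677) (n (n (l 2320) (l 2677) (l 2531)) (l 2677) (n (l 2677)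
  (n (l 1801) (l 2677) (l 0)) (l 0)))) (l 2729) (n (n (n (n (l 1448) (l 1448) (l 732)) (l 1801) (l 0)) (n (l
  2547) (l 2547) (l 2174)) (l 0)) (n (l 2673) (l 2673) (n (l 2300) (l 2673) (l 2547))) (l 2673))) (n (l 2784) (l
  2784) (n (l 2765) (l 2765) (n (n (n (l 1807) (l 2765) (l 0)) (l 2765) (l 2765)) (l 2765) (l 0)))) (n (l 0) (n
  (n (l 2610) (l 2610) (n (l 2268) (l 2610) (l 2519))) (l 2694) (n (n (l 1448) (l 1805) (l 0)) (n (l 2550) (l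
  2550) (l 2178)) (l 0))) (l 0)))) (n (n (n (l 2686) (n (l 2641) (l 2674) (l 2686)) (l 2686)) (n (n (n (l 2396)
  (n (n (l 1411) (l 1998) (l 2396)) (l 2396) (l 2396)) (l 2396)) (n (n (l 0) (l 0) (n (l 2026) (l 1014) (l
  2026))) (l 2369) (n (l 2369) (n (l 1357) (l 2026) (l 2369)) (l 2369))) (l 2539)) (n (l 0) (l 0) (n (n (l 2185)
  (n (l 1258) (l 1940) (l 2185)) (l 2185)) (n (l 0) (l 0) (n (l 2028) (l 1014) (l 2028))) (l 2419))) (n (l 2654)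
  (l 2602) (l 2654))) (l 2706)) (n (n (n (n (l 1995) (n (l 1644) (l 1905) (l 1995)) (l 1995)) (n (n (l 643) (l
  0) (l 996)) (l 1736) (n (l 1736) (l 1357) (l 1736))) (l 2139)) (n (l 0) (l 0) (n (n (l 1768) (l 1369) (l
  1768)) (n (l 643) (l 0) (l 1008)) (l 1768))) (n (l 2356) (n (l 2256) (n (n (l 1309) (l 1961) (l 2256)) (l 0)
  (l 2256)) (l 2256)) (l 2356))) (l 0) (n (n (l 2657) (l 2604) (l 2657)) (n (n (l 2353) (n (n (l 1392) (l 1974)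
  (l 2353)) (l 2353) (l 2353)) (l 2353)) (n (n (l 0) (l 0) (n (l 2024) (l 1014) (l 2024))) (l 0) (n (l 2370) (n
  (l 1014) (l 2024) (l 2024)) (l 2370))) (l 2503)) (l 2657))) (n (l 2753) (n (l 2739) (n (n (l 2611) (l 2699) (l
  2739)) (l 0) (l 2739)) (l 2739)) (n (n (n (l 2706) (l 2706) (n (n (l 1745) (l 2706) (l 0)) (l 2706) (l 2706)))
  (l 2753) (n (l 0) (n (l 2738) (l 2738) (n (l 1745) (l 2738) (l 0))) (l 0))) (l 2753) (l 0)))) (n (n (n (n (l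
  2510) (l 2510) (n (l 2381) (l 2510) (l 2477))) (l 2563) (n (n (n (l 1881) (l 1881) (n (l 975) (l 1881) (l
  1644))) (l 2142) (n (l 0) (n (l 1723) (l 1723) (l 739)) (l 1723))) (n (l 2414) (l 2414) (l 2275)) (n (l 0) (n
  (n (l 1776) (l 1776) (l 739)) (l 1776) (l 0)) (l 0)))) (n (l 2662) (l 2662) (n (l 2625) (l 2625) (n (n (l
  2277) (l 2625) (l 2516)) (l 2625) (l 0)))) (n (n (n (n (l 1278) (l 1278) (l 1006)) (l 1406) (n (l 363) (l 692)
  (l 0))) (n (l 1727) (l 1727) (n (l 1591) (l 1591) (n (l 739) (l 1591) (l 0)))) (l 0)) (n (n (l 2424) (l 2424)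
  (l 2277)) (l 2424) (n (n (l 1827) (l 1827) (n (l 975) (l 1827) (l 1591))) (l 2098) (n (l 0) (n (l 1727) (l
  1727) (l 739)) (l 0)))) (l 0))) (n (n (l 2791) (l 2791) (n (l 2771) (l 2771) (n (n (n (l 1813) (l 2771) (l 0))
  (l 2771) (l 0)) (l 2771) (l 0)))) (n (n (l 2774) (n (n (l 2431) (l 0) (l 2774)) (l 0) (l 2774)) (l 2774)) (l
  0) (l 2791)) (n (n (l 2672) (l 2672) (n (n (l 2318) (l 2672) (l 2532)) (l 2672) (n (l 0) (n (l 1806) (l 2672)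
  (l 0)) (l 0)))) (l 2727) (n (n (n (l 1455) (l 1806) (l 0)) (n (l 2551) (l 2551) (l 2179)) (l 0)) (n (l 2678)
  (l 2678) (n (l 2179) (l 2551) (l 2551))) (l 0)))) (l 0)))) (n (n (n (n (n (l 2575) (l 2575) (l 2561)) (l 2581)
  (n (n (l 2466) (l 2466) (n (n (n (l 1163) (l 2143) (l 2009)) (l 2466) (l 2331)) (l 2466) (l 2466))) (l 2534)
  (n (n (n (l 0) (n (l 2021) (l 2021) (l 1029)) (l 0)) (n (l 2357) (l 2357) (n (l 1029) (l 2021) (l 2021))) (l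
  0)) (n (l 2475) (l 2475) (n (n (l 1147) (l 2139) (l 2021)) (l 2475) (l 2357))) (l 0)))) (n (l 2617) (n (n (n
  (n (l 2490) (n (l 1591) (l 0) (l 2490)) (l 2490)) (l 0) (l 2617)) (l 0) (l 2617)) (l 0) (l 2617)) (n (l 2610)
  (l 2610) (n (l 2566) (l 2610) (l 0)))) (n (n (n (l 2218) (l 2218) (n (n (l 1621) (l 1980) (n (l 1745) (l 1220)
  (l 1943))) (l 2218) (n (l 2156) (n (l 1310) (l 2156) (l 1868)) (l 0)))) (l 2325) (n (n (n (l 665) (l 1023) (l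
  0)) (n (l 1752) (l 1752) (l 1386)) (l 1752)) (n (l 2092) (l 2092) (n (l 1493) (l 1832) (l 1825))) (n (l 0) (n
  (l 0) (n (l 1894) (l 0) (l 1022)) (l 0)) (l 0)))) (n (l 2459) (l 2459) (n (l 2403) (l 2403) (n (n (n (l 1438)
  (l 2403) (l 1994)) (l 2403) (l 2403)) (l 2403) (l 0)))) (n (n (l 0) (n (n (l 1777) (l 1777) (l 1391)) (l 1777)
  (n (l 665) (l 1027) (l 0))) (l 0)) (n (n (l 2065) (l 2065) (n (l 1581) (l 1924) (l 1834))) (l 2151) (n (n (l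
  665) (l 1027) (l 0)) (n (l 1762) (l 1762) (l 1391)) (l 1762))) (l 0)))) (n (n (l 2686) (n (n (n (l 2637) (n (n
  (l 1670) (l 0) (l 2637)) (l 2637) (l 2637)) (l 2637)) (n (l 0) (l 2667) (n (l 2667) (n (l 1670) (l 0) (l
  2667)) (l 2667))) (l 2686)) (n (l 0) (l 0) (n (n (l 2568) (n (l 1670) (l 0) (l 2568)) (l 2568)) (l 0) (l
  2686))) (l 2686)) (n (l 2679) (l 2679) (n (n (l 2552) (l 2679) (l 0)) (l 2679) (l 0)))) (n (n (n (n (l 2456)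
  (n (l 2109) (l 2365) (l 2456)) (l 2456)) (n (n (l 1307) (l 0) (l 1652)) (l 0) (n (l 2397) (l 2019) (l 2397)))
  (l 2551)) (l 0) (n (l 2668) (n (l 2617) (n (n (l 1670) (l 0) (l 2617)) (l 0) (l 2617)) (l 2617)) (l 2668))) (l
  0) (n (l 2686) (n (n (l 2617) (n (n (l 1670) (l 0) (l 2617)) (l 2617) (l 2617)) (l 2617)) (n (l 0) (l 0) (n (l
  2668) (n (l 1670) (l 0) (l 2668)) (l 2668))) (l 2668)) (l 2686))) (n (n (l 2649) (l 2649) (n (l 2604) (l 2649)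
  (l 2637))) (l 2662) (n (n (n (l 2387) (l 2387) (n (n (l 1416) (l 2387) (l 1995)) (l 2387) (l 2387))) (l 2528)
  (n (n (l 0) (n (l 2027) (l 2027) (l 1024)) (l 0)) (n (l 2368) (l 2368) (n (l 1024) (l 2027) (l 2027))) (l 0)))
  (n (l 2643) (l 2643) (l 2592)) (l 0)))) (n (n (n (n (l 1876) (l 1876) (n (l 1679) (l 1803) (l 1770))) (l 1947)
  (n (n (n (l 1130) (l 1130) (n (l 276) (l 1130) (l 904))) (l 1392) (n (l 0) (n (l 981) (l 981) (l 50)) (l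
  981))) (n (l 1707) (l 1707) (l 1567)) (n (l 1613) (n (l 663) (l 986) (l 0)) (l 0)))) (n (l 2096) (l 2096) (n
  (l 2040) (l 2040) (n (n (l 1577) (l 1925) (l 1816)) (l 2040) (l 0)))) (n (n (n (n (l 534) (l 534) (l 270)) (l
  663) (l 1)) (n (l 938) (l 938) (l 801)) (l 0)) (n (n (l 1621) (l 1621) (l 1476)) (l 1621) (n (n (l 1073) (l
  1073) (n (l 227) (l 1073) (l 847))) (l 1346) (n (l 0) (n (l 938) (l 938) (l 1)) (l 0)))) (l 1709))) (n (n (l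
  2319) (l 2319) (n (l 2280) (l 2280) (n (n (n (l 1334) (l 2280) (l 1971)) (l 2280) (l 0)) (l 2280) (l 0)))) (l
  2319) (n (n (l 2128) (l 2128) (n (n (l 1545) (l 1897) (l 1867)) (l 2128) (n (l 0) (n (l 1234) (l 2065) (l
  1849)) (l 0)))) (l 2218) (n (n (n (l 666) (l 1018) (l 0)) (n (l 1751) (l 1751) (l 1382)) (l 1751)) (n (l 2112)
  (l 2112) (n (l 1482) (l 1851) (l 1851))) (l 0)))) (n (l 0) (n (n (n (l 1542) (l 1542) (l 1439)) (l 1587) (n (l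
  1062) (l 1309) (n (l 0) (n (l 928) (l 928) (l 1)) (l 0)))) (n (l 1729) (l 0) (n (l 1685) (l 1685) (n (l 1356)
  (l 1685) (l 0)))) (n (n (l 533) (l 665) (l 1)) (n (l 939) (l 939) (l 802)) (l 0))) (l 0)))) (n (n (n (l 2793)
  (n (n (l 2777) (n (n (n (l 1805) (l 0) (l 2777)) (l 2777) (l 2777)) (l 2777) (l 2777)) (l 2777)) (n (n (l 0)
  (l 0) (n (l 2789) (n (l 1805) (l 0) (l 2789)) (l 2789))) (l 0) (n (l 2789) (n (n (l 1805) (l 0) (l 2789)) (l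
  2789) (l 2789)) (l 2789))) (l 2793)) (n (l 2788) (l 2788) (n (n (n (l 2442) (l 2788) (l 0)) (l 2788) (l 0)) (l
  2788) (l 0)))) (n (n (n (l 2682) (n (n (l 2320) (l 2536) (l 2682)) (n (l 2682) (l 0) (n (l 1801) (l 0) (l
  2682))) (l 2682)) (l 2682)) (n (n (n (n (l 1448) (l 732) (l 1448)) (l 0) (l 1801)) (l 0) (n (l 2547) (l 2174)
  (l 2547))) (l 2673) (n (l 2673) (n (l 2300) (l 2547) (l 2673)) (l 2673))) (l 2735)) (n (l 0) (l 0) (n (n (l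
  2609) (n (l 2268) (l 2519) (l 2609)) (l 2609)) (n (n (l 1448) (l 0) (l 1805)) (l 0) (n (l 2552) (l 2178) (l
  2552))) (l 2696))) (n (l 2784) (n (l 2765) (n (n (n (l 1807) (l 0) (l 2765)) (l 2765) (l 2765)) (l 0) (l
  2765)) (l 2765)) (l 2784))) (n (n (l 2760) (l 2760) (n (n (l 2628) (l 2760) (l 2707)) (l 2760) (n (l 0) (n (l
  2441) (l 2760) (l 0)) (l 0)))) (l 2778) (n (n (n (n (l 2183) (l 2183) (n (l 1242) (l 2183) (l 1938))) (l 2441)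
  (n (l 0) (n (l 2024) (l 2024) (l 997)) (l 0))) (n (l 2712) (l 2712) (l 2575)) (l 0)) (n (l 2758) (l 2758) (n
  (l 2575) (l 2712) (l 2712))) (l 0)))) (n (n (n (n (l 2510) (n (l 2381) (l 2477) (l 2510)) (l 2510)) (n (n (n
  (l 1880) (n (l 975) (l 1644) (l 1880)) (l 1880)) (n (l 0) (l 1722) (n (l 1722) (l 738) (l 1722))) (l 2142)) (n
  (l 0) (l 0) (l 1776)) (n (l 2414) (l 2275) (l 2414))) (l 2563)) (n (n (n (n (l 1278) (l 1006) (l 1278)) (n (l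
  363) (l 0) (l 692)) (l 1406)) (l 0) (n (l 1727) (n (l 1591) (n (l 738) (l 0) (l 1591)) (l 1591)) (l 1727))) (l
  0) (n (n (l 2424) (l 2277) (l 2424)) (n (n (l 1827) (n (l 975) (l 1591) (l 1827)) (l 1827)) (n (l 0) (l 0) (n
  (l 1727) (l 738) (l 1727))) (l 2098)) (l 2424))) (n (l 2662) (n (l 2625) (n (n (l 2276) (l 2516) (l 2625)) (l
  0) (l 2625)) (l 2625)) (l 2662))) (l 0) (n (n (l 2791) (n (l 2771) (n (n (n (l 1813) (l 0) (l 2771)) (l 0) (l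
  2771)) (l 0) (l 2771)) (l 2771)) (l 2791)) (n (n (l 2672) (n (n (l 2318) (l 2532) (l 2672)) (n (l 0) (l 0) (n
  (l 1806) (l 0) (l 2672))) (l 2672)) (l 2672)) (n (n (n (l 1455) (l 0) (l 1806)) (l 0) (n (l 2551) (l 2179) (l
  2551))) (l 0) (n (l 2678) (n (l 2179) (l 2551) (l 2551)) (l 2678))) (l 2727)) (n (n (l 2774) (l 2774) (n (n (l
  2431) (l 2774) (l 0)) (l 2774) (l 0))) (l 2791) (l 0)))) (n (n (n (l 2686) (l 2686) (n (l 2641) (l 2686) (l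
  2674))) (l 2706) (n (n (n (l 2380) (l 2380) (n (n (l 1411) (l 2380) (l 1983)) (l 2380) (l 2380))) (l 2523) (n
  (n (l 0) (n (l 2026) (l 2026) (l 1014)) (l 0)) (n (l 2369) (l 2369) (n (l 1357) (l 2369) (l 2026))) (l 2369)))
  (n (l 2654) (l 2654) (l 2602)) (n (l 0) (n (n (l 2185) (l 2185) (n (l 1258) (l 2185) (l 1940))) (l 2415) (n (l
  0) (n (l 2024) (l 2024) (l 1014)) (l 0))) (l 0)))) (n (l 2753) (n (n (n (l 2706) (n (n (l 1745) (l 0) (l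
  2706)) (l 2706) (l 2706)) (l 2706)) (n (l 0) (l 0) (n (l 2738) (n (l 1745) (l 0) (l 2738)) (l 2738))) (l
  2753)) (l 0) (l 2753)) (n (l 2739) (l 2739) (n (n (l 2611) (l 2739) (l 2699)) (l 2739) (l 0)))) (n (n (n (n (l
  1995) (l 1995) (n (l 1644) (l 1995) (l 1905))) (l 2139) (n (n (l 643) (l 996) (l 0)) (n (l 1736) (l 1736) (l
  1357)) (l 1736))) (n (l 2356) (l 2356) (n (l 2256) (l 2256) (n (n (l 1309) (l 2256) (l 1961)) (l 2256) (l
  0)))) (n (l 0) (n (n (l 1768) (l 1768) (l 1369)) (l 1768) (n (l 643) (l 1008) (l 0))) (l 0))) (n (n (l 2657)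
  (l 2657) (l 2603)) (l 2657) (n (n (l 2353) (l 2353) (n (n (l 1392) (l 2353) (l 1974)) (l 2353) (l 2353))) (l
  2503) (n (n (l 0) (n (l 2024) (l 2024) (l 1014)) (l 0)) (n (l 2370) (l 2370) (n (l 1014) (l 2024) (l 2024)))
  (l 0)))) (l 0)))) (n (n (n (n (n (l 1466) (l 1466) (l 1429)) (l 1484) (n (n (l 1242) (l 1242) (n (n (l 366) (l
  1242) (l 877)) (l 1242) (l 1242))) (l 1381) (n (n (l 0) (n (l 912) (l 912) (l 1)) (l 0)) (n (l 1233) (l 1233)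
  (n (l 321) (l 1233) (l 912))) (l 0)))) (n (l 1559) (l 1559) (n (l 1541) (l 1541) (n (l 1420) (l 1541) (l 0))))
  (n (n (n (l 870) (l 870) (n (l 536) (l 870) (l 783))) (l 1013) (n (l 1) (n (l 635) (l 635) (l 273)) (l 634)))
  (n (l 1214) (l 1214) (l 1111)) (n (l 0) (n (n (l 654) (l 654) (l 272)) (l 654) (l 1)) (l 0)))) (n (n (l 1707)
  (l 1707) (n (l 1687) (l 1687) (n (n (l 1342) (l 1687) (l 0)) (l 1687) (l 0)))) (l 1707) (n (n (l 1606) (l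
  1606) (n (l 1485) (l 1606) (l 1573))) (l 1643) (n (n (l 1065) (l 1321) (n (l 0) (n (l 927) (l 927) (l 1)) (l
  0))) (n (l 1591) (l 1591) (l 1452)) (l 0)))) (n (n (n (n (l 471) (l 471) (l 371)) (l 518) (n (l 134) (l 255)
  (l 1))) (n (l 636) (l 636) (n (l 586) (l 586) (n (l 272) (l 586) (l 0)))) (l 1)) (n (n (l 893) (l 893) (l
  839)) (l 893) (n (n (l 673) (l 673) (n (l 359) (l 673) (l 586))) (l 773) (n (l 1) (n (l 636) (l 636) (l 272))
  (l 0)))) (l 0))) (n (n (n (l 1982) (l 1982) (n (l 1968) (l 1968) (n (n (n (l 1028) (l 1968) (l 0)) (l 1968) (l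
  0)) (l 1968) (l 0)))) (l 1988) (n (n (l 1885) (l 1885) (n (n (l 1528) (l 1885) (l 1741)) (l 1885) (n (l 0) (n
  (l 1020) (l 1885) (l 0)) (l 0)))) (l 1936) (n (n (n (l 668) (l 1020) (l 0)) (n (l 1754) (l 1754) (l 1384)) (l
  0)) (n (l 1880) (l 1880) (n (l 1384) (l 1754) (l 1754))) (l 0)))) (n (n (l 2005) (n (n (n (l 1879) (n (l 984)
  (l 0) (l 1879)) (l 1879)) (l 0) (l 2005)) (l 0) (l 2005)) (l 2005)) (l 0) (n (l 2005) (l 2005) (n (n (l 1961)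
  (l 1961) (n (n (l 1028) (l 1961) (l 0)) (l 1961) (l 0))) (l 2005) (l 0)))) (n (n (n (l 1698) (l 1698) (n (l
  1574) (l 1698) (l 1665))) (l 1752) (n (n (l 1080) (l 1338) (l 933)) (n (l 1609) (l 1609) (l 1469)) (n (l 0) (n
  (l 665) (l 984) (l 0)) (l 0)))) (n (l 1859) (l 1859) (n (l 1822) (l 1822) (n (n (l 1474) (l 1822) (l 1713)) (l
  1822) (l 0)))) (n (n (n (l 536) (l 665) (l 1)) (n (l 939) (l 939) (l 802)) (l 0)) (n (n (l 1624) (l 1624) (l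
  1478)) (l 1624) (n (l 1029) (l 1301) (n (l 0) (n (l 939) (l 939) (l 1)) (l 0)))) (l 0)))) (l 0)))
end

set_option maxRecDepth 100000 in
theorem cert_chk : chk cert cert [] = true := by decide +kernel

theorem cert_dep : cert.dep ≤ 12 := by decide +kernel

theorem vx_rot (d : Fin 4) : vx (d + 1) = - vy d := by fin_cases d <;> rfl
theorem vy_rot (d : Fin 4) : vy (d + 1) = vx d := by fin_cases d <;> rfl

theorem hit_rot (w : List (Fin 4)) : ∀ h x y, hit w (h + 1) (-y) x = hit w h x y := by
  induction w with
  | nil => intros; rfl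
  | cons t ts ih =>
    intro h x y
    have e : h + 1 - t = (h - t) + 1 := by abel
    simp only [hit, e, vx_rot, vy_rot]
    rw [show -y + -vy (h - t) = -(y + vy (h-t)) by ring, ih]
    congr 1
    rw [Bool.eq_iff_iff]
    simp
    constructor <;> rintro ⟨h1, h2⟩ <;> constructor <;> linarith

theorem clash_rot (h : Fin 4) (w : List (Fin 4)) : clash h w = clash 0 w := by
  have key : ∀ h, clash (h + 1) w = clash h w := by
    intro h
    unfold clash
    rw [vx_rot, vy_rot, hit_rot]
  have h1 := key 0
  have h2 := key 1
  have h3 := key 2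
  fin_cases h
  · rfl
  · exact h1
  · exact h2.trans h1
  · exact h3.trans (h2.trans h1)

theorem hit_mono (u r : List (Fin 4)) : ∀ h x y, hit u h x y = true → hit (u ++ r) h x y = true := by
  induction u with
  | nil => intro h x y hh; simp [hit] at hh
  | cons t ts ih =>
    intro h x y hh
    simp only [hit, List.cons_append, Bool.or_eq_true] at hh ⊢
    rcases hh with hh | hh
    · exact Or.inl hh
    · exact Or.inr (ih _ _ _ hh)

theorem clash_mono (u r : List (Fin 4)) (h) (hh : clash h u = true) : clash h (u ++ r) = true :=
  hit_mono _ _ _ _ _ hh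

theorem si_mono (u r : List (Fin 4)) (hh : si u = true) : si (u ++ r) = true := by
  induction u with
  | nil => simp [si] at hh
  | cons t ts ih =>
    simp only [si, List.cons_append, Bool.or_eq_true] at hh ⊢
    rcases hh with hh | hh
    · exact Or.inl (clash_mono _ _ _ hh)
    · exact Or.inr (ih hh)

theorem look_le_mx (T : Tr) : ∀ w, T.look w ≤ T.mx := by
  induction T with
  | l k => intro w; simp [Tr.look, Tr.mx]
  | n a b c iha ihb ihc =>
    intro w
    rcases w with _ | ⟨t, ts⟩
    · simp [Tr.look, Tr.mx]
    · have := iha ts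
      have := ihb ts
      have := ihc ts
      fin_cases t <;> simp [Tr.look, Tr.mx] <;> omega

theorem look_mono (T : Tr) : ∀ u r, T.look (u ++ r) ≤ T.look u := by
  induction T with
  | l k => intro u r; simp [Tr.look]
  | n a b c iha ihb ihc =>
    intro u r
    rcases u with _ | ⟨t, ts⟩
    · exact look_le_mx (.n a b c) _
    · have := iha ts r
      have := ihb ts r
      have := ihc ts r
      fin_cases t <;> simp [Tr.look] <;> omega

theorem fw_mono (T : Tr) (u r) : fw T (u ++ r) ≤ fw T u := by
  unfold fw
  rcases h : clash 0 u with _ | _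
  · have := look_mono T u r
    rcases clash 0 (u ++ r) with _ | _ <;> simp [this]
  · rw [clash_mono u r 0 h]

theorem chk_spec (T S : Tr) : ∀ u r, chk T S u = true → S.dep ≤ r.length → (∀ t ∈ r, t ≠ 2) →
    si (u ++ r) = false → 1 ≤ S.look r ∧
    500 * (fw T (0 :: (u ++ r)) + fw T (1 :: (u ++ r)) + fw T (3 :: (u ++ r))) ≤ 1359 * S.look r := by
  induction S with
  | l k =>
    intro u r h _ _ hs
    simp only [chk, Bool.or_eq_true, Bool.and_eq_true, Nat.ble_eq] at h
    rcases h with h | h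
    · rw [si_mono u r h] at hs; cases hs
    · have h0 := fw_mono T (0 :: u) r
      have h1 := fw_mono T (1 :: u) r
      have h3 := fw_mono T (3 :: u) r
      simp only [List.cons_append] at h0 h1 h3
      simp only [Tr.look]
      omega
  | n a b c iha ihb ihc =>
    intro u r h hd h2 hs
    simp only [chk, Bool.and_eq_true] at h
    simp only [Tr.dep] at hd
    rcases r with _ | ⟨t, ts⟩
    · simp at hd
    · have hts : ∀ t ∈ ts, t ≠ 2 := fun s hs => h2 s (List.mem_cons_of_mem _ hs)
      have ht := h2 t (List.mem_cons_self)
      simp only [List.length_cons] at hd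
      have e : ∀ s : Fin 4, u ++ s :: ts = (u ++ [s]) ++ ts := by simp
      rw [e] at hs ⊢
      fin_cases t
      · exact iha _ ts h.1 (by omega) hts hs
      · exact ihb _ ts h.2.1 (by omega) hts hs
      · exact absurd rfl ht
      · exact ihc _ ts h.2.2 (by omega) hts hs

def saw (ds : List (Fin 4)) : Prop := ∀ B, B <:+: ds → B ≠ [] → vsum B ≠ 0

def turns : List (Fin 4) → List (Fin 4)
  | [] => []
  | [_] => []
  | a :: b :: l => (a - b) :: turns (b :: l)

theorem turns_length (l : List (Fin 4)) : (turns l).length = l.length - 1 := by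
  induction l with
  | nil => rfl
  | cons a l ih =>
    rcases l with _ | ⟨b, l⟩
    · rfl
    · simp only [turns, List.length_cons] at *
      omega

theorem hit_turns (l : List (Fin 4)) : ∀ d x y, hit (turns (d :: l)) d x y = true →
    ∃ B, B <+: l ∧ B ≠ [] ∧ ((x, y) : Site) + vsum B = 0 := by
  induction l with
  | nil => intro d x y h; simp [turns, hit] at h
  | cons b l ih =>
    intro d x y h
    simp only [turns, hit, Bool.or_eq_true, Bool.and_eq_true, beq_iff_eq, sub_sub_cancel] at h
    rcases h with h | h
    · refine ⟨[b], by simp, by simp, ?_⟩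
      simp [vsum, dv, Prod.ext_iff, h]
    · obtain ⟨B, h1, h2, h3⟩ := ih _ _ _ h
      refine ⟨b :: B, by simpa using h1, by simp, ?_⟩
      rw [← h3]
      simp [vsum, dv, Prod.ext_iff, add_assoc]

theorem saw_clash (d l) (h : saw (d :: l)) : clash 0 (turns (d :: l)) = false := by
  by_contra hc
  rw [Bool.not_eq_false, ← clash_rot d] at hc
  obtain ⟨B, h1, h2, h3⟩ := hit_turns l d _ _ hc
  refine h (d :: B) ?_ (by simp) ?_
  · have : d :: B <+: d :: l := by simpa using h1
    exact this.isInfix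
  · rw [← h3]; simp [vsum, dv]

theorem saw_tail (d l) (h : saw (d :: l)) : saw l := by
  intro B hB
  exact h B (hB.trans (List.suffix_cons d l).isInfix)

theorem saw_si (l) (h : saw l) : si (turns l) = false := by
  induction l with
  | nil => rfl
  | cons a l ih =>
    have := ih (saw_tail _ _ h)
    rcases l with _ | ⟨b, l⟩
    · rfl
    · have h2 := saw_clash _ _ h
      simp only [turns] at h2 ⊢
      simp [si, h2, this]

theorem saw_turns_ne (l) (h : saw l) : ∀ t ∈ turns l, t ≠ 2 := by
  induction l with
  | nil => simp [turns]
  | cons a l ih =>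
    have h3 := ih (saw_tail _ _ h)
    rcases l with _ | ⟨b, l⟩
    · simp [turns]
    · simp only [turns, List.mem_cons, forall_eq_or_imp]
      refine ⟨?_, h3⟩
      intro hab
      refine h [a, b] ?_ (by simp) ?_
      · exact (show [a, b] <+: a :: b :: l by simp).isInfix
      · have : a = b + 2 := by rw [← hab]; abel
        subst this
        fin_cases b <;> simp [vsum, dv, vx, vy]

def phi (l : List (Fin 4)) : ℕ := cert.look (turns l)

theorem phi_step (l : List (Fin 4)) (hl : 13 ≤ l.length) (h : saw l) :
    1 ≤ phi l ∧ 500 * ∑ d : Fin 4, (if saw (d :: l) then phi (d :: l) else 0) ≤ 1359 * phi l := by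
  have hd : cert.dep ≤ (turns l).length := by
    rw [turns_length]; have := cert_dep; omega
  obtain ⟨h1, h2⟩ := chk_spec cert cert [] (turns l) cert_chk hd (saw_turns_ne l h) (by simpa using saw_si l h)
  refine ⟨h1, le_trans ?_ h2⟩
  rcases l with _ | ⟨b, l⟩
  · simp at hl
  have key : ∀ d : Fin 4, (if saw (d :: b :: l) then phi (d :: b :: l) else 0) ≤
      if d - b = 2 then 0 else fw cert ((d - b) :: turns (b :: l)) := by
    intro d
    split_ifs with h3 h4
    · exact absurd h4 (saw_turns_ne _ h3 _ (by simp [turns]))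
    · have := saw_clash _ _ h3
      simp only [turns] at this
      simp [fw, this, phi, turns]
    · exact le_rfl
    · exact Nat.zero_le _
  have := Finset.sum_le_sum (fun d (_ : d ∈ Finset.univ) => key d)
  refine Nat.mul_le_mul_left 500 (this.trans (le_of_eq ?_))
  rw [← Equiv.sum_comp (Equiv.addRight b)]
  simp [Fin.sum_univ_four]

def sawF : ℕ → Finset (List (Fin 4))
  | 0 => {[]}
  | k + 1 => (((Finset.univ : Finset (Fin 4)) ×ˢ sawF k).image (fun p => p.1 :: p.2)).filter saw

theorem mem_sawF (k : ℕ) : ∀ l, l ∈ sawF k ↔ l.length = k ∧ saw l := by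
  induction k with
  | zero =>
    intro l
    simp only [sawF, Finset.mem_singleton, List.length_eq_zero_iff]
    constructor
    · rintro rfl
      refine ⟨rfl, ?_⟩
      intro B hB h
      simp at hB
      exact absurd hB h
    · exact fun h => h.1
  | succ k ih =>
    intro l
    simp only [sawF, Finset.mem_filter, Finset.mem_image, Finset.mem_product, Finset.mem_univ, true_and, ih, Prod.exists]
    constructor
    · rintro ⟨⟨a, b, ⟨h1, h2⟩, rfl⟩, h3⟩
      exact ⟨by simp [h1], h3⟩
    · rintro ⟨h1, h2⟩
      rcases l with _ | ⟨a, l⟩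
      · simp at h1
      · exact ⟨⟨a, l, ⟨by simpa using h1, saw_tail _ _ h2⟩, rfl⟩, h2⟩

theorem sawF_step (k : ℕ) (hk : 13 ≤ k) :
    500 * ∑ l ∈ sawF (k + 1), phi l ≤ 1359 * ∑ l ∈ sawF k, phi l := by
  rw [sawF, Finset.sum_filter, Finset.sum_image, Finset.sum_product_right, Finset.mul_sum, Finset.mul_sum]
  · refine Finset.sum_le_sum fun l hl => ?_
    rw [mem_sawF] at hl
    exact (phi_step l (by omega) hl.2).2
  · rintro ⟨a, b⟩ _ ⟨c, d⟩ _ h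
    simpa using h

theorem sawF_card : ∃ C : ℝ, 0 < C ∧ ∀ k, ((sawF k).card : ℝ) ≤ C * (1359 / 500 : ℝ) ^ k := by
  have h1 : ∀ k, ((∑ l ∈ sawF (13 + k), phi l : ℕ) : ℝ) ≤ (∑ l ∈ sawF 13, phi l : ℕ) * (1359 / 500 : ℝ) ^ k := by
    intro k
    induction k with
    | zero => simp
    | succ k ih =>
      have := sawF_step (13 + k) (by omega)
      have h : (500 : ℝ) * ((∑ l ∈ sawF (13 + k + 1), phi l : ℕ) : ℝ) ≤ 1359 * ((∑ l ∈ sawF (13 + k), phi l : ℕ) : ℝ) := by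
        exact_mod_cast this
      rw [← add_assoc, pow_succ]
      linarith
  have h2 : ∀ k, 13 ≤ k → (sawF k).card ≤ ∑ l ∈ sawF k, phi l := by
    intro k hk
    rw [Finset.card_eq_sum_ones]
    refine Finset.sum_le_sum fun l hl => ?_
    rw [mem_sawF] at hl
    exact (phi_step l (by omega) hl.2).1
  refine ⟨(∑ l ∈ sawF 13, phi l : ℕ) + ∑ k ∈ Finset.range 13, ((sawF k).card : ℝ) + 1, by positivity, ?_⟩
  intro k
  have hpos : (0:ℝ) ≤ ∑ k ∈ Finset.range 13, ((sawF k).card : ℝ) := by positivity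
  have hpos2 : (0:ℝ) ≤ (∑ l ∈ sawF 13, phi l : ℕ) := by positivity
  have hp : (1:ℝ) ≤ (1359 / 500 : ℝ) ^ k := one_le_pow₀ (by norm_num)
  by_cases hk : k < 13
  · have := Finset.single_le_sum (f := fun k => ((sawF k).card : ℝ)) (fun _ _ => by positivity) (Finset.mem_range.2 hk)
    nlinarith
  · obtain ⟨j, rfl⟩ := Nat.exists_eq_add_of_le (not_lt.1 hk)
    have h3 : ((sawF (13 + j)).card : ℝ) ≤ (∑ l ∈ sawF (13 + j), phi l : ℕ) := by
      exact_mod_cast h2 _ (by omega)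
    have h4 := h1 j
    have h5 : (1359 / 500 : ℝ) ^ j ≤ (1359 / 500 : ℝ) ^ (13 + j) :=
      pow_le_pow_right₀ (by norm_num) (by omega)
    have : (∑ l ∈ sawF 13, phi l : ℕ) * (1359 / 500 : ℝ) ^ j ≤ (∑ l ∈ sawF 13, phi l : ℕ) * (1359 / 500 : ℝ) ^ (13 + j) := by gcongr
    nlinarith

/-! ### Energy, partition functions -/

def cf (Λ : Finset Site) (y : Site) : ℝ := if y ∈ Λ then 1 / 2 else 1

theorem cf_ge (Λ y) : 1 / 2 ≤ cf Λ y := by unfold cf; split_ifs <;> norm_num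
theorem cf_nonneg (Λ y) : 0 ≤ cf Λ y := by linarith [cf_ge Λ y]
theorem cf_le (Λ y) : cf Λ y ≤ 1 := by unfold cf; split_ifs <;> norm_num

def en (Λ : Finset Site) (η : Config) : ℝ :=
  ∑ x ∈ Λ, ∑ y ∈ nbrs x, cf Λ y * ((|η x - η y| : ℤ) : ℝ)

theorem sosH_eq (Λ : Finset Site) (ξ : Config) (g) :
    sosH Λ ξ (extendC Λ ξ g) = en Λ (extendC Λ ξ g) := by
  unfold sosH en
  rw [Finset.mul_sum, ← Finset.sum_add_distrib]
  refine Finset.sum_congr rfl fun x hx => ?_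
  rw [← Finset.sum_filter_add_sum_filter_not (nbrs x) (fun y => y ∈ Λ), Finset.mul_sum]
  congr 1
  · refine Finset.sum_congr rfl fun y hy => ?_
    rw [Finset.mem_filter] at hy
    simp [cf, hy.2]
  · refine Finset.sum_congr rfl fun y hy => ?_
    rw [Finset.mem_filter] at hy
    simp [cf, hy.2, extendC]

def wt (β : ℝ) (Λ : Finset Site) (η : Config) : ENNReal := ENNReal.ofReal (Real.exp (-β * en Λ η))

def ZE (β : ℝ) (Λ : Finset Site) (ξ : Config) : ENNReal := ∑' g, wt β Λ (extendC Λ ξ g)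

def PE (β : ℝ) (Λ : Finset Site) (A : Set Config) : ENNReal :=
  ∑' g, A.indicator (wt β Λ) (extendC Λ 0 g)

theorem gProb_eq (β : ℝ) (Λ : Finset Site) (A : Set Config) :
    gProb β Λ 0 Set.univ (fun _ => 0) A = (PE β Λ A).toReal / (ZE β Λ 0).toReal := by
  unfold gProb PE ZE
  rw [ENNReal.tsum_toReal_eq, ENNReal.tsum_toReal_eq]
  · have h : ∀ g, gWeight β Λ 0 Set.univ (fun _ => 0) (extendC Λ 0 g) = (wt β Λ (extendC Λ 0 g)).toReal := by
      intro g
      simp [gWeight, wt, sosH_eq, Real.exp_nonneg]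
    congr 1
    · refine tsum_congr fun g => ?_
      by_cases hA : extendC Λ 0 g ∈ A
      · simp only [Set.indicator_of_mem hA, h]
      · simp [Set.indicator_of_notMem hA]
    · exact tsum_congr h
  · intro g; simp [wt]
  · intro g
    by_cases hA : extendC Λ 0 g ∈ A
    · simp [Set.indicator_of_mem hA, wt]
    · simp [Set.indicator_of_notMem hA]

theorem pi_tsum_le {ι : Type*} [Fintype ι] (f : ℤ → ENNReal) :
    ∑' k : ι → ℤ, ∏ i, f (k i) ≤ ∏ _i : ι, ∑' n, f n := by
  rw [ENNReal.tsum_eq_iSup_sum]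
  refine iSup_le fun s => ?_
  calc ∑ k ∈ s, ∏ i, f (k i) ≤ ∑ k ∈ Fintype.piFinset (fun i => s.image (fun k => k i)), ∏ i, f (k i) := by
        refine Finset.sum_le_sum_of_subset fun k hk => ?_
        rw [Fintype.mem_piFinset]
        intro i
        exact Finset.mem_image_of_mem _ hk
    _ = ∏ i, ∑ n ∈ s.image (fun k => k i), f n := by rw [Finset.prod_univ_sum]
    _ ≤ _ := Finset.prod_le_prod' fun i _ => ENNReal.sum_le_tsum _

theorem right_mem_nbrs (x : Site) : (x.1 + 1, x.2) ∈ nbrs x := by simp [nbrs]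

theorem out_exists (Λ : Finset Site) (x : Site) : ∃ n : ℕ, (x.1 + n, x.2) ∉ Λ := by
  by_contra! h
  have : Set.Finite (Set.range (fun n : ℕ => ((x.1 + n, x.2) : Site))) :=
    Λ.finite_toSet.subset (by rintro _ ⟨n, rfl⟩; exact h n)
  refine Set.infinite_range_of_injective ?_ this
  intro a b hab
  simpa using hab

theorem diff_inj (Λ : Finset Site) : Function.Injective (fun (g : {x // x ∈ Λ} → ℤ) (x : {x // x ∈ Λ}) =>
    extendC Λ 0 g x - extendC Λ 0 g (x.1.1 + 1, x.1.2)) := by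
  intro g g' h
  have key : ∀ n : ℕ, ∀ x : Site, (x.1 + n, x.2) ∉ Λ → extendC Λ 0 g x = extendC Λ 0 g' x := by
    intro n
    induction n with
    | zero => intro x hx; simp at hx; simp [extendC, hx]
    | succ n ih =>
      intro x hx
      by_cases hxL : x ∈ Λ
      · have h1 := congrFun h ⟨x, hxL⟩
        have h2 := ih (x.1 + 1, x.2) (by convert hx using 2; push_cast; ring_nf)
        simp only at h1
        omega
      · simp [extendC, hxL]
  funext x
  obtain ⟨n, hn⟩ := out_exists Λ x.1
  have := key n x.1 hn
  simpa [extendC] using this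

theorem tsum_exp_lt_top (c : ℝ) (hc : 0 < c) :
    ∑' n : ℤ, ENNReal.ofReal (Real.exp (-c * |(n:ℝ)|)) < ⊤ := by
  have : Summable (fun n : ℤ => Real.exp (-c * |(n:ℝ)|)) := by
    have h1 : Summable (fun n : ℕ => Real.exp (-c * n)) := by
      have := Real.summable_exp_nat_mul_iff.2 (show -c < 0 by linarith)
      simpa [mul_comm] using this
    refine Summable.of_nat_of_neg ?_ ?_ <;> simpa using h1
  exact this.tsum_ofReal_lt_top

theorem ZE_lt_top (β : ℝ) (hβ : 0 < β) (Λ : Finset Site) : ZE β Λ 0 < ⊤ := by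
  set f : ℤ → ENNReal := fun n => ENNReal.ofReal (Real.exp (-(β / 2) * |(n:ℝ)|)) with hf
  have h1 : ∀ g, wt β Λ (extendC Λ 0 g) ≤ ∏ x : {x // x ∈ Λ}, f (extendC Λ 0 g x - extendC Λ 0 g (x.1.1 + 1, x.1.2)) := by
    intro g
    rw [hf]
    simp only
    rw [← ENNReal.ofReal_prod_of_nonneg (fun _ _ => Real.exp_nonneg _), ← Real.exp_sum, wt]
    refine ENNReal.ofReal_le_ofReal (Real.exp_le_exp.2 ?_)
    rw [← Finset.mul_sum, Finset.univ_eq_attach, Finset.sum_attach Λ (fun x => |((extendC Λ 0 g x - extendC Λ 0 g (x.1 + 1, x.2) : ℤ) : ℝ)|)]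
    have : (1/2) * ∑ x ∈ Λ, |((extendC Λ 0 g x - extendC Λ 0 g (x.1 + 1, x.2) : ℤ) : ℝ)| ≤ en Λ (extendC Λ 0 g) := by
      rw [Finset.mul_sum, en]
      refine Finset.sum_le_sum fun x hx => ?_
      refine le_trans ?_ (Finset.single_le_sum (f := fun y => cf Λ y * ((|extendC Λ 0 g x - extendC Λ 0 g y| : ℤ) : ℝ)) (fun y _ => ?_) (right_mem_nbrs x))
      · rw [Int.cast_abs]
        exact mul_le_mul_of_nonneg_right (cf_ge _ _) (abs_nonneg _)
      · exact mul_nonneg (cf_nonneg _ _) (by positivity)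
    nlinarith
  calc ZE β Λ 0 ≤ ∑' g : {x // x ∈ Λ} → ℤ, ∏ x : {x // x ∈ Λ}, f (extendC Λ 0 g x - extendC Λ 0 g (x.1.1 + 1, x.1.2)) :=
        ENNReal.tsum_le_tsum h1
    _ ≤ ∑' k : {x // x ∈ Λ} → ℤ, ∏ x, f (k x) :=
        ENNReal.tsum_comp_le_tsum_of_injective (diff_inj Λ) (fun k => ∏ x, f (k x))
    _ ≤ _ := pi_tsum_le f
    _ < ⊤ := by
        refine ENNReal.prod_lt_top fun _ _ => ?_
        exact tsum_exp_lt_top _ (by linarith)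

theorem ZE_pos (β : ℝ) (Λ : Finset Site) (ξ) : 0 < ZE β Λ ξ := by
  refine lt_of_lt_of_le ?_ (ENNReal.le_tsum 0)
  simp [wt, Real.exp_pos]

/-! ### Comparison of boundary conditions -/

theorem abs_submod (a b c d : ℤ) : |a ⊓ c - b ⊓ d| + |a ⊔ c - b ⊔ d| ≤ |a - b| + |c - d| := by
  rcases le_total a c with h1 | h1 <;> rcases le_total b d with h2 | h2 <;>
    simp only [inf_of_le_left, inf_of_le_right, sup_of_le_left, sup_of_le_right, h1, h2] <;>
    grind

theorem en_submod (Λ) (η ζ : Config) : en Λ (η ⊓ ζ) + en Λ (η ⊔ ζ) ≤ en Λ η + en Λ ζ := by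
  unfold en
  simp only [← Finset.sum_add_distrib, ← mul_add]
  refine Finset.sum_le_sum fun x _ => Finset.sum_le_sum fun y _ => ?_
  refine mul_le_mul_of_nonneg_left ?_ (cf_nonneg _ _)
  exact_mod_cast abs_submod (η x) (η y) (ζ x) (ζ y)

theorem extendC_inf (Λ ξ₁ ξ₂ g₁ g₂) : extendC Λ (ξ₁ ⊓ ξ₂) (g₁ ⊓ g₂) = extendC Λ ξ₁ g₁ ⊓ extendC Λ ξ₂ g₂ := by
  funext x; by_cases h : x ∈ Λ <;> simp [extendC, h]
theorem extendC_sup (Λ ξ₁ ξ₂ g₁ g₂) : extendC Λ (ξ₁ ⊔ ξ₂) (g₁ ⊔ g₂) = extendC Λ ξ₁ g₁ ⊔ extendC Λ ξ₂ g₂ := by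
  funext x; by_cases h : x ∈ Λ <;> simp [extendC, h]

open scoped FinsetFamily in
theorem ZE_four (β : ℝ) (hβ : 0 < β) (Λ ξ₁ ξ₂) : ZE β Λ ξ₁ * ZE β Λ ξ₂ ≤ ZE β Λ (ξ₁ ⊓ ξ₂) * ZE β Λ (ξ₁ ⊔ ξ₂) := by
  set w : Config → ({x // x ∈ Λ} → ℤ) → ℝ := fun ξ g => Real.exp (-β * en Λ (extendC Λ ξ g)) with hw
  have hw0 : ∀ ξ g, 0 ≤ w ξ g := fun _ _ => Real.exp_nonneg _
  have hsum : ∀ ξ (s : Finset ({x // x ∈ Λ} → ℤ)), ∑ g ∈ s, wt β Λ (extendC Λ ξ g) = ENNReal.ofReal (∑ g ∈ s, w ξ g) := by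
    intro ξ s
    rw [ENNReal.ofReal_sum_of_nonneg (fun _ _ => hw0 _ _)]; rfl
  have key : ∀ s t : Finset ({x // x ∈ Λ} → ℤ), (∑ g ∈ s, wt β Λ (extendC Λ ξ₁ g)) * (∑ g ∈ t, wt β Λ (extendC Λ ξ₂ g))
      ≤ ZE β Λ (ξ₁ ⊓ ξ₂) * ZE β Λ (ξ₁ ⊔ ξ₂) := by
    intro s t
    have := four_functions_theorem (f₁ := w ξ₁) (f₂ := w ξ₂) (f₃ := w (ξ₁ ⊓ ξ₂)) (f₄ := w (ξ₁ ⊔ ξ₂))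
      (hw0 _) (hw0 _) (hw0 _) (hw0 _) (fun a b => by
        simp only [hw, extendC_inf, extendC_sup]
        rw [← Real.exp_add, ← Real.exp_add, Real.exp_le_exp]
        have := en_submod Λ (extendC Λ ξ₁ a) (extendC Λ ξ₂ b)
        nlinarith) s t
    refine le_trans ?_ (mul_le_mul' (ENNReal.sum_le_tsum (s ⊼ t)) (ENNReal.sum_le_tsum (s ⊻ t)))
    · rw [hsum, hsum, hsum, hsum, ← ENNReal.ofReal_mul (Finset.sum_nonneg fun _ _ => hw0 _ _),
        ← ENNReal.ofReal_mul (Finset.sum_nonneg fun _ _ => hw0 _ _)]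
      exact ENNReal.ofReal_le_ofReal this
  conv_lhs => rw [ZE, ZE, ENNReal.tsum_eq_iSup_sum, ENNReal.tsum_eq_iSup_sum]
  rw [ENNReal.iSup_mul]
  refine iSup_le fun s => ?_
  rw [ENNReal.mul_iSup]
  exact iSup_le fun t => key s t

theorem ZE_add (β Λ ξ) (t : ℤ) : ZE β Λ (fun x => ξ x + t) = ZE β Λ ξ := by
  unfold ZE
  rw [← Equiv.tsum_eq (Equiv.addRight (fun _ : {x // x ∈ Λ} => t))]
  refine tsum_congr fun g => ?_
  have : extendC Λ (fun x => ξ x + t) (g + fun _ => t) = fun x => extendC Λ ξ g x + t := by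
    funext x; by_cases h : x ∈ Λ <;> simp [extendC, h]
  simp [this, wt, en]

theorem extendC_neg (Λ ξ g) : extendC Λ (-ξ) (-g) = - extendC Λ ξ g := by
  funext x; by_cases h : x ∈ Λ <;> simp [extendC, h]

theorem en_neg (Λ η) : en Λ (-η) = en Λ η := by
  unfold en
  refine Finset.sum_congr rfl fun x _ => Finset.sum_congr rfl fun y _ => ?_
  rw [Pi.neg_apply, Pi.neg_apply, ← abs_neg]; congr 3; ring

theorem ZE_neg (β Λ ξ) : ZE β Λ (-ξ) = ZE β Λ ξ := by
  unfold ZE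
  rw [← Equiv.tsum_eq (Equiv.neg _)]
  refine tsum_congr fun g => ?_
  simp [extendC_neg, wt, en_neg]

theorem ZE_fold (β : ℝ) (hβ : 0 < β) (Λ ξ) (t : ℤ) : ZE β Λ ξ ≤ ZE β Λ (fun x => ξ x ⊔ (t - ξ x)) := by
  have h := ZE_four β hβ Λ (fun x => ξ x + (-t)) (-ξ)
  rw [ZE_add, ZE_neg] at h
  have h1 : (fun x => ξ x + (-t)) ⊓ (-ξ) = - (fun x => ξ x ⊔ (t - ξ x)) := by
    funext x; simp only [Pi.inf_apply, Pi.neg_apply]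
    rw [neg_sup, inf_comm]; congr 1; ring
  have h2 : (fun x => ξ x + (-t)) ⊔ (-ξ) = fun x => (ξ x ⊔ (t - ξ x)) + (-t) := by
    funext x; simp only [Pi.sup_apply, Pi.neg_apply]
    rw [sup_add]; congr 1; ring
  rw [h1, h2, ZE_add, ZE_neg] at h
  by_contra! hlt
  exact absurd h (not_le.2 (ENNReal.mul_lt_mul hlt hlt))

theorem ZE_le_zero_aux (β : ℝ) (hβ : 0 < β) (Λ) (m : ℕ) : ∀ ξ : Config, (∀ x, 0 ≤ ξ x) → (∀ x, ξ x ≤ m) →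
    ZE β Λ ξ ≤ ZE β Λ 0 := by
  induction m with
  | zero =>
    intro ξ h1 h2
    have : ξ = 0 := by funext x; exact le_antisymm (by simpa using h2 x) (h1 x)
    rw [this]
  | succ m ih =>
    intro ξ h1 h2
    have h := ZE_fold β hβ Λ (-ξ) (-1)
    rw [ZE_neg] at h
    refine h.trans (ih _ ?_ ?_)
    · intro x
      have := h1 x
      simp only [Pi.neg_apply]; omega
    · intro x
      have h3 := h1 x; have h4 := h2 x
      push_cast at h4
      simp only [Pi.neg_apply]; omega

theorem ZE_le_zero (β : ℝ) (hβ : 0 < β) (Λ ξ) (m : ℕ) (hm : ∀ x, |ξ x| ≤ (m:ℤ)) : ZE β Λ ξ ≤ ZE β Λ 0 := by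
  refine (ZE_fold β hβ Λ ξ 0).trans (ZE_le_zero_aux β hβ Λ m _ ?_ ?_) <;> intro x <;> have := hm x <;>
    rw [abs_le] at this <;> omega

/-! ### Local moves and the lower bound -/

theorem nbrs_symm (x y : Site) (h : y ∈ nbrs x) : x ∈ nbrs y := by
  obtain ⟨x1, x2⟩ := x
  obtain ⟨y1, y2⟩ := y
  simp only [nbrs, Finset.mem_insert, Finset.mem_singleton, Prod.mk.injEq] at h ⊢
  omega

theorem nbrs_ne (x y : Site) (h : y ∈ nbrs x) : x ≠ y := by
  obtain ⟨x1, x2⟩ := x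
  obtain ⟨y1, y2⟩ := y
  simp only [nbrs, Finset.mem_insert, Finset.mem_singleton, Prod.mk.injEq, ne_eq] at h ⊢
  omega

theorem nbrs_card (x : Site) : (nbrs x).card = 4 := by
  unfold nbrs
  rw [Finset.card_insert_of_notMem, Finset.card_insert_of_notMem, Finset.card_insert_of_notMem, Finset.card_singleton] <;>
  simp only [Finset.mem_insert, Finset.mem_singleton, Prod.mk.injEq] <;> omega

theorem sym_sum (Λ : Finset Site) (U : Site → Site → ℝ) (hU : ∀ x y, x ∉ Λ → U x y = 0) :
    ∑ x ∈ Λ, ∑ y ∈ nbrs x, cf Λ y * (U x y + U y x) = ∑ x ∈ Λ, ∑ y ∈ nbrs x, U x y := by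
  have e : ∀ f : Site → Site → ℝ, ∑ x ∈ Λ, ∑ y ∈ nbrs x, f x y =
      ∑ x ∈ Λ, ∑ y ∈ (nbrs x).filter (· ∈ Λ), f x y + ∑ x ∈ Λ, ∑ y ∈ (nbrs x).filter (· ∉ Λ), f x y := by
    intro f
    rw [← Finset.sum_add_distrib]
    exact Finset.sum_congr rfl fun x _ => (Finset.sum_filter_add_sum_filter_not _ _ _).symm
  rw [e, e]
  congr 1
  · have h1 : ∑ x ∈ Λ, ∑ y ∈ (nbrs x).filter (· ∈ Λ), U y x = ∑ x ∈ Λ, ∑ y ∈ (nbrs x).filter (· ∈ Λ), U x y := by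
      refine Finset.sum_comm' ?_
      intro x y
      simp only [Finset.mem_filter]
      constructor
      · rintro ⟨h1, h2, h3⟩; exact ⟨⟨nbrs_symm _ _ h2, h1⟩, h3⟩
      · rintro ⟨⟨h2, h1⟩, h3⟩; exact ⟨h1, nbrs_symm _ _ h2, h3⟩
    have h2 : ∑ x ∈ Λ, ∑ y ∈ (nbrs x).filter (· ∈ Λ), cf Λ y * (U x y + U y x) =
      1 / 2 * (∑ x ∈ Λ, ∑ y ∈ (nbrs x).filter (· ∈ Λ), U x y + ∑ x ∈ Λ, ∑ y ∈ (nbrs x).filter (· ∈ Λ), U y x) := by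
      rw [← Finset.sum_add_distrib, Finset.mul_sum]
      refine Finset.sum_congr rfl fun x _ => ?_
      rw [← Finset.sum_add_distrib, Finset.mul_sum]
      refine Finset.sum_congr rfl fun y hy => ?_
      rw [Finset.mem_filter] at hy
      simp [cf, hy.2]
    rw [h2, h1]; ring
  · refine Finset.sum_congr rfl fun x _ => Finset.sum_congr rfl fun y hy => ?_
    rw [Finset.mem_filter] at hy
    simp [cf, hy.2, hU y x hy.2]

theorem en_le_add (Λ : Finset Site) (η ζ : Config) (U : Site → Site → ℝ) (hU : ∀ x y, x ∉ Λ → U x y = 0)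
    (h : ∀ x ∈ Λ, ∀ y ∈ nbrs x, ((|η x - η y| : ℤ) : ℝ) ≤ ((|ζ x - ζ y| : ℤ) : ℝ) + (U x y + U y x)) :
    en Λ η ≤ en Λ ζ + ∑ x ∈ Λ, ∑ y ∈ nbrs x, U x y := by
  rw [← sym_sum Λ U hU]
  unfold en
  rw [← Finset.sum_add_distrib]
  refine Finset.sum_le_sum fun x hx => ?_
  rw [← Finset.sum_add_distrib]
  refine Finset.sum_le_sum fun y hy => ?_
  rw [← mul_add]
  exact mul_le_mul_of_nonneg_left (h x hx y hy) (cf_nonneg _ _)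

theorem en_add_le (Λ : Finset Site) (η ζ : Config) (U : Site → Site → ℝ) (hU : ∀ x y, x ∉ Λ → U x y = 0)
    (h : ∀ x ∈ Λ, ∀ y ∈ nbrs x, ((|ζ x - ζ y| : ℤ) : ℝ) + (U x y + U y x) ≤ ((|η x - η y| : ℤ) : ℝ)) :
    en Λ ζ + ∑ x ∈ Λ, ∑ y ∈ nbrs x, U x y ≤ en Λ η := by
  rw [← sym_sum Λ U hU]
  unfold en
  rw [← Finset.sum_add_distrib]
  refine Finset.sum_le_sum fun x hx => ?_
  rw [← Finset.sum_add_distrib]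
  refine Finset.sum_le_sum fun y hy => ?_
  rw [← mul_add]
  exact mul_le_mul_of_nonneg_left (h x hx y hy) (cf_nonneg _ _)

theorem sum_single (Λ : Finset Site) (v : Site) (hv : v ∈ Λ) (k : ℝ) :
    ∑ x ∈ Λ, ∑ y ∈ nbrs x, (if x = v then k else 0) = 4 * k := by
  simp [Finset.sum_ite_eq', hv, nbrs_card]

theorem wt_le (β : ℝ) (hβ : 0 < β) (Λ) (η ζ) (k : ℝ) (h : en Λ ζ + k ≤ en Λ η) :
    wt β Λ η ≤ ENNReal.ofReal (Real.exp (-β * k)) * wt β Λ ζ := by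
  unfold wt
  rw [← ENNReal.ofReal_mul (Real.exp_nonneg _), ← Real.exp_add]
  refine ENNReal.ofReal_le_ofReal (Real.exp_le_exp.2 ?_)
  nlinarith

theorem extendC_sub (Λ f g) : extendC Λ (-f) (g - fun x => f x.1) = extendC Λ 0 g - f := by
  funext x; by_cases h : x ∈ Λ <;> simp [extendC, h]

theorem PE_shift (β : ℝ) (Λ) (f : Config) (A A' : Set Config) (K : ENNReal)
    (h : ∀ g, extendC Λ 0 g ∈ A → extendC Λ 0 g - f ∈ A' ∧ wt β Λ (extendC Λ 0 g) ≤ K * wt β Λ (extendC Λ 0 g - f)) :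
    PE β Λ A ≤ K * ∑' g, A'.indicator (wt β Λ) (extendC Λ (-f) g) := by
  unfold PE
  rw [← ENNReal.tsum_mul_left, ← Equiv.tsum_eq (Equiv.subRight (fun x : {x // x ∈ Λ} => f x.1)) (fun g => K * A'.indicator (wt β Λ) (extendC Λ (-f) g))]
  refine ENNReal.tsum_le_tsum fun g => ?_
  rw [Equiv.subRight_apply, extendC_sub]
  by_cases hA : extendC Λ 0 g ∈ A
  · rw [Set.indicator_of_mem hA, Set.indicator_of_mem (h g hA).1]
    exact (h g hA).2
  · rw [Set.indicator_of_notMem hA]; exact zero_le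

theorem PE_shift_in (β : ℝ) (Λ) (f : Config) (hf : ∀ x, x ∉ Λ → f x = 0) (A A' : Set Config) (K : ENNReal)
    (h : ∀ g, extendC Λ 0 g ∈ A → extendC Λ 0 g - f ∈ A' ∧ wt β Λ (extendC Λ 0 g) ≤ K * wt β Λ (extendC Λ 0 g - f)) :
    PE β Λ A ≤ K * PE β Λ A' := by
  refine (PE_shift β Λ f A A' K h).trans (le_of_eq ?_)
  unfold PE
  congr 1
  refine tsum_congr fun g => ?_
  congr 1
  funext x
  by_cases h : x ∈ Λ
  · simp [extendC, h]
  · simp [extendC, h, hf x h]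

theorem PE_mono (β Λ) {A B : Set Config} (h : A ⊆ B) : PE β Λ A ≤ PE β Λ B :=
  ENNReal.tsum_le_tsum fun _ => Set.indicator_le_indicator_of_subset h (fun _ => zero_le) _

theorem PE_univ (β Λ) : PE β Λ Set.univ = ZE β Λ 0 := by simp [PE, ZE]

theorem PE_union (β Λ) (A B : Set Config) : PE β Λ (A ∪ B) ≤ PE β Λ A + PE β Λ B := by
  unfold PE
  rw [← ENNReal.tsum_add]
  refine ENNReal.tsum_le_tsum fun g => ?_
  by_cases hA : extendC Λ 0 g ∈ A
  · rw [Set.indicator_of_mem hA, Set.indicator_of_mem (Set.mem_union_left B hA)]; exact le_self_add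
  · by_cases hB : extendC Λ 0 g ∈ B
    · rw [Set.indicator_of_mem hB, Set.indicator_of_mem (Set.mem_union_right A hB)]; exact le_add_self
    · rw [Set.indicator_of_notMem (by simp [hA, hB])]; exact zero_le

theorem PE_sUnion {ι : Type*} (β Λ) (s : Finset ι) (A : Set Config) (B : ι → Set Config)
    (h : ∀ η ∈ A, ∃ i ∈ s, η ∈ B i) : PE β Λ A ≤ ∑ i ∈ s, PE β Λ (B i) := by
  unfold PE
  rw [← Summable.tsum_finsetSum (fun _ _ => ENNReal.summable)]
  refine ENNReal.tsum_le_tsum fun g => ?_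
  by_cases hA : extendC Λ 0 g ∈ A
  · obtain ⟨i, hi, hB⟩ := h _ hA
    rw [Set.indicator_of_mem hA]
    refine le_trans (le_of_eq ?_) (Finset.single_le_sum (f := fun i => (B i).indicator (wt β Λ) (extendC Λ 0 g)) (fun _ _ => zero_le) hi)
    simp only [Set.indicator_of_mem hB]
  · rw [Set.indicator_of_notMem hA]; exact zero_le

theorem lower_bound (β : ℝ) (hβ : 0 < β) (Λ : Finset Site) (v : Site) (hv : v ∈ Λ) (h : ℕ) :
    ZE β Λ 0 ≤ 2 * ENNReal.ofReal (Real.exp (4 * β * h)) * PE β Λ {η | (h:ℤ) ≤ η v} := by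
  have h1 : ZE β Λ 0 ≤ 2 * PE β Λ {η | 0 ≤ η v} := by
    have e : PE β Λ {η | η v ≤ 0} = PE β Λ {η | 0 ≤ η v} := by
      unfold PE
      rw [← Equiv.tsum_eq (Equiv.neg _)]
      refine tsum_congr fun g => ?_
      have h0 := extendC_neg Λ 0 g
      rw [neg_zero] at h0
      rw [Equiv.neg_apply, h0]
      simp only [Set.indicator_apply, Set.mem_ofPred_eq, Pi.neg_apply, Left.neg_nonpos_iff, wt, en_neg]
    rw [two_mul]
    nth_rw 1 [← e]
    rw [← PE_univ]
    refine le_trans (PE_mono β Λ ?_) (PE_union β Λ _ _)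
    intro η _
    rcases le_total (η v) 0 with h | h
    · exact Set.mem_union_left _ h
    · exact Set.mem_union_right _ h
  have h2 : PE β Λ {η | 0 ≤ η v} ≤ ENNReal.ofReal (Real.exp (4 * β * h)) * PE β Λ {η | (h:ℤ) ≤ η v} := by
    refine PE_shift_in β Λ (fun x => if x = v then -(h:ℤ) else 0) ?_ _ _ _ ?_
    · intro x hx; rw [if_neg]; rintro rfl; exact hx hv
    · intro g hg
      simp only [Set.mem_ofPred_eq] at hg
      constructor
      · simp [hg]
      · have := en_le_add Λ (extendC Λ 0 g - fun x => if x = v then -(h:ℤ) else 0) (extendC Λ 0 g) (fun x _ => if x = v then (h:ℝ) else 0)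
          (by intro x _ hx; rw [if_neg]; rintro rfl; exact hx hv)
          (by
            intro x hx y hy
            have hne := nbrs_ne _ _ hy
            have : |(extendC Λ 0 g - fun x => if x = v then -(h:ℤ) else 0) x - (extendC Λ 0 g - fun x => if x = v then -(h:ℤ) else 0) y| ≤
              |extendC Λ 0 g x - extendC Λ 0 g y| + ((if x = v then (h:ℤ) else 0) + if y = v then (h:ℤ) else 0) := by
              simp only [Pi.sub_apply]
              split_ifs <;> grind
            have h3 := (Int.cast_le (R := ℝ)).2 this
            push_cast at h3 ⊢
            exact h3)
        rw [sum_single Λ v hv] at this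
        refine (wt_le β hβ Λ _ (extendC Λ 0 g - fun x => if x = v then -(h:ℤ) else 0) (-(4 * h)) (by linarith)).trans (le_of_eq ?_)
        congr 3; ring
  calc _ ≤ _ := h1
    _ ≤ 2 * (ENNReal.ofReal (Real.exp (4 * β * h)) * PE β Λ {η | (h:ℤ) ≤ η v}) := by gcongr
    _ = _ := by ring

/-! ### Dual walks, winding numbers -/

def lo (d : Fin 4) : Site := match d with | 0 => (0, 0) | 1 => (-1, 0) | 2 => (-1, -1) | 3 => (0, -1)
def ro (d : Fin 4) : Site := match d with | 0 => (0, -1) | 1 => (0, 0) | 2 => (-1, 0) | 3 => (-1, -1)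

abbrev DE : Type := Site × Fin 4

def lc (e : DE) : Site := e.1 + lo e.2
def rc (e : DE) : Site := e.1 + ro e.2

def edges : Site → List (Fin 4) → List DE
  | _, [] => []
  | p, d :: ds => (p, d) :: edges (p + dv d) ds

theorem vsum_nil : vsum [] = 0 := rfl
theorem vsum_cons (d l) : vsum (d :: l) = dv d + vsum l := by simp [vsum]
theorem vsum_append (a b) : vsum (a ++ b) = vsum a + vsum b := by simp [vsum]

theorem edges_append (a b : List (Fin 4)) : ∀ p, edges p (a ++ b) = edges p a ++ edges (p + vsum a) b := by
  induction a with
  | nil => intro p; simp [edges, vsum]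
  | cons d a ih => intro p; simp [edges, ih, vsum_cons, add_assoc]

theorem edges_length (a : List (Fin 4)) : ∀ p, (edges p a).length = a.length := by
  induction a with
  | nil => intro p; rfl
  | cons d a ih => intro p; simp [edges, ih]

theorem mem_edges (ds : List (Fin 4)) : ∀ p e, e ∈ edges p ds → ∃ A C, ds = A ++ e.2 :: C ∧ e.1 = p + vsum A := by
  induction ds with
  | nil => intro p e h; simp [edges] at h
  | cons d ds ih =>
    intro p e h
    rw [edges, List.mem_cons] at h
    rcases h with rfl | h
    · exact ⟨[], ds, rfl, by simp [vsum]⟩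
    · obtain ⟨A, C, h1, h2⟩ := ih _ _ h
      exact ⟨d :: A, C, by simp [← h1], by rw [h2, vsum_cons, add_assoc]⟩

def cr (x : Site) (e : DE) : ℤ :=
  (if e.2 = 1 ∧ e.1.2 = x.2 ∧ x.1 < e.1.1 then 1 else 0) - (if e.2 = 3 ∧ e.1.2 = x.2 + 1 ∧ x.1 < e.1.1 then 1 else 0)

def cu (x : Site) (e : DE) : ℤ :=
  (if e.2 = 2 ∧ e.1.1 = x.1 + 1 ∧ x.2 < e.1.2 then 1 else 0) - (if e.2 = 0 ∧ e.1.1 = x.1 ∧ x.2 < e.1.2 then 1 else 0)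

def lsum (f : DE → ℤ) (L : List DE) : ℤ := (L.map f).sum

theorem lsum_nil (f) : lsum f [] = 0 := rfl
theorem lsum_cons (f a L) : lsum f (a :: L) = f a + lsum f L := by simp [lsum]
theorem lsum_append (f L M) : lsum f (L ++ M) = lsum f L + lsum f M := by simp [lsum]

theorem lsum_tele (f : DE → ℤ) (F : Site → ℤ) (ds : List (Fin 4)) : ∀ p,
    (∀ e ∈ edges p ds, f e = F (e.1 + dv e.2) - F e.1) → lsum f (edges p ds) = F (p + vsum ds) - F p := by
  induction ds with
  | nil => intro p _; simp [edges, lsum, vsum]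
  | cons d ds ih =>
    intro p h
    rw [edges, lsum_cons, ih, h (p, d) (by simp [edges]), vsum_cons, ← add_assoc]
    · simp
    · intro e he
      exact h e (by simp [edges, he])

theorem lsum_pos_mem (f : DE → ℤ) (L : List DE) (h : 0 < lsum f L) : ∃ e ∈ L, 0 < f e := by
  by_contra! hh
  have : lsum f L ≤ 0 := by
    clear h
    induction L with
    | nil => simp [lsum]
    | cons a L ih =>
      rw [lsum_cons]
      have h1 := hh a (by simp)
      have h2 := ih (fun e he => hh e (by simp [he]))
      omega
  omega

def wind (x : Site) (L : List DE) : ℤ := lsum (cr x) L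

def ui (x y : Site) (e : DE) : ℤ := if lc e = x ∧ rc e = y then 1 else 0

def us (x y : Site) (L : List DE) : ℤ := lsum (ui x y) L

theorem lsum_sub (f g : DE → ℤ) (L) : lsum (fun e => f e - g e) L = lsum f L - lsum g L := by
  induction L with
  | nil => rfl
  | cons a L ih => simp only [lsum_cons, ih]; ring

theorem grad_aux (x y : Site) (hxy : y = (x.1 + 1, x.2) ∨ y = (x.1, x.2 + 1)) (p ds) (h : vsum ds = 0) :
    wind x (edges p ds) - wind y (edges p ds) = us x y (edges p ds) - us y x (edges p ds) := by
  obtain ⟨x1, x2⟩ := x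
  rcases hxy with rfl | rfl
  · have : lsum (fun e => (cr (x1, x2) e - cr (x1 + 1, x2) e) - (ui (x1, x2) (x1 + 1, x2) e - ui (x1 + 1, x2) (x1, x2) e)) (edges p ds) = 0 := by
      rw [lsum_tele _ (fun _ => 0)]
      · simp
      · rintro ⟨⟨a, b⟩, d⟩ _
        fin_cases d <;> simp [cr, ui, lc, rc, lo, ro, Prod.ext_iff] <;> grind
    rw [lsum_sub, lsum_sub, lsum_sub] at this
    simp only [wind, us]
    linarith
  · have : lsum (fun e => (cr (x1, x2) e - cr (x1, x2 + 1) e) - (ui (x1, x2) (x1, x2 + 1) e - ui (x1, x2 + 1) (x1, x2) e)) (edges p ds) = 0 := by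
      rw [lsum_tele _ (fun q => if q.2 = x2 + 1 ∧ x1 < q.1 then 1 else 0)]
      · simp [h]
      · rintro ⟨⟨a, b⟩, d⟩ _
        fin_cases d <;> simp [cr, ui, lc, rc, lo, ro, dv, vx, vy, Prod.ext_iff] <;> grind
    rw [lsum_sub, lsum_sub, lsum_sub] at this
    simp only [wind, us]
    linarith

theorem grad (x y : Site) (hxy : y ∈ nbrs x) (p ds) (h : vsum ds = 0) :
    wind x (edges p ds) - wind y (edges p ds) = us x y (edges p ds) - us y x (edges p ds) := by
  obtain ⟨x1, x2⟩ := x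
  simp only [nbrs, Finset.mem_insert, Finset.mem_singleton] at hxy
  rcases hxy with rfl | rfl | rfl | rfl
  · exact grad_aux _ _ (Or.inl rfl) p ds h
  · have := grad_aux (x1 - 1, x2) (x1, x2) (Or.inl (by simp)) p ds h
    linarith
  · exact grad_aux _ _ (Or.inr rfl) p ds h
  · have := grad_aux (x1, x2 - 1) (x1, x2) (Or.inr (by simp)) p ds h
    linarith

theorem wind_eq_cu (x : Site) (p ds) (h : vsum ds = 0) : wind x (edges p ds) = lsum (cu x) (edges p ds) := by
  obtain ⟨x1, x2⟩ := x
  have : lsum (fun e => cr (x1, x2) e - cu (x1, x2) e) (edges p ds) = 0 := by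
    rw [lsum_tele _ (fun q => if x1 < q.1 ∧ x2 < q.2 then 1 else 0)]
    · simp [h]
    · rintro ⟨⟨a, b⟩, d⟩ _
      fin_cases d <;> simp [cr, cu, dv, vx, vy] <;> grind
  rw [lsum_sub] at this
  unfold wind
  linarith

/-! ### Boundary edges of a finite set -/

def bd (S : Finset Site) (e : DE) : Prop := lc e ∈ S ∧ rc e ∉ S

def bdF (S : Finset Site) : Finset DE :=
  ((S ×ˢ (Finset.univ : Finset (Fin 4))).image (fun z => ((z.1 - lo z.2, z.2) : DE))).filter (bd S)

theorem mem_bdF (S e) : e ∈ bdF S ↔ bd S e := by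
  simp only [bdF, Finset.mem_filter, and_iff_right_iff_imp]
  intro h
  rw [Finset.mem_image]
  refine ⟨(lc e, e.2), by simp [h.1], ?_⟩
  simp [lc]

theorem bdF_card (S) : (bdF S).card ≤ 4 * S.card := by
  refine (Finset.card_filter_le _ _).trans (Finset.card_image_le.trans ?_)
  simp [mul_comm]

def nx (S : Finset Site) (e : DE) : DE :=
  (e.1 + dv e.2, if lc (e.1 + dv e.2, e.2) ∉ S then e.2 + 1 else if rc (e.1 + dv e.2, e.2) ∉ S then e.2 else e.2 - 1)

def pv (S : Finset Site) (e : DE) : DE :=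
  let d := if lc (e.1 - dv e.2, e.2) ∉ S then e.2 - 1 else if rc (e.1 - dv e.2, e.2) ∉ S then e.2 else e.2 + 1
  (e.1 - dv d, d)

theorem turn1 (p d) : lc (p + dv d, d + 1) = lc (p, d) := by
  obtain ⟨a, b⟩ := p; fin_cases d <;> simp [lc, lo, dv, vx, vy, add_assoc]
theorem turn2 (p d) : rc (p, d + 1) = lc (p, d) := by
  obtain ⟨a, b⟩ := p; fin_cases d <;> simp [lc, rc, lo, ro, add_assoc]
theorem turn3 (p d) : rc (p + dv d, d - 1) = rc (p, d) := by
  obtain ⟨a, b⟩ := p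
  obtain ⟨e, rfl⟩ : ∃ e, d = e + 1 := ⟨d - 1, by simp⟩
  rw [add_sub_cancel_right]
  fin_cases e <;> simp [rc, ro, dv, vx, vy, add_assoc]
theorem turn4 (p d) : lc (p, d - 1) = rc (p, d) := by
  have := turn2 p (d - 1)
  rw [sub_add_cancel] at this
  exact this.symm
theorem turn5 (p d) : lc (p + dv d - dv (d + 1), d + 1) = rc (p, d) := by
  obtain ⟨a, b⟩ := p; fin_cases d <;> simp [lc, lo, rc, ro, dv, vx, vy] <;> try ring
theorem turn6 (p d) : lc (p - dv (d - 1), d - 1) = lc (p, d) := by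
  obtain ⟨a, b⟩ := p
  obtain ⟨e, rfl⟩ : ∃ e, d = e + 1 := ⟨d - 1, by simp⟩
  rw [add_sub_cancel_right]
  fin_cases e <;> simp [lc, lo, dv, vx, vy] <;> try ring
theorem turn7 (p d) : rc (p + dv d - dv (d - 1), d - 1) = lc (p, d) := by
  obtain ⟨a, b⟩ := p
  obtain ⟨e, rfl⟩ : ∃ e, d = e + 1 := ⟨d - 1, by simp⟩
  rw [add_sub_cancel_right]
  fin_cases e <;> simp [lc, lo, rc, ro, dv, vx, vy] <;> try ring

theorem nx_bd (S e) (h : bd S e) : bd S (nx S e) := by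
  obtain ⟨p, d⟩ := e
  unfold nx bd at *
  simp only
  by_cases h1 : lc (p + dv d, d) ∈ S
  · by_cases h2 : rc (p + dv d, d) ∈ S
    · simp only [h1, h2, not_true_eq_false, if_false]
      rw [turn3, turn4]; exact ⟨h2, h.2⟩
    · simp only [h1, h2, not_true_eq_false, not_false_eq_true, if_true, if_false]
      exact ⟨trivial, trivial⟩
  · simp only [h1, not_false_eq_true, if_true]
    rw [turn1, turn2]; exact ⟨h.1, h1⟩

theorem pv_nx (S e) (h : bd S e) : pv S (nx S e) = e := by
  obtain ⟨p, d⟩ := e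
  unfold nx bd at *
  simp only
  by_cases h1 : lc (p + dv d, d) ∈ S
  · by_cases h2 : rc (p + dv d, d) ∈ S
    · simp only [h1, h2, not_true_eq_false, if_false]
      have h3 : lc (p + dv d - dv (d - 1), d - 1) ∈ S := by rw [turn6]; exact h1
      have h4 : rc (p + dv d - dv (d - 1), d - 1) ∈ S := by rw [turn7]; exact h.1
      simp [pv, h3, h4]
    · simp only [h1, h2, not_true_eq_false, not_false_eq_true, if_true, if_false]
      simp [pv, h.1, h.2]
  · simp only [h1, not_false_eq_true, if_true]
    have : lc (p + dv d - dv (d + 1), d + 1) ∉ S := by rw [turn5]; exact h.2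
    simp [pv, this]

theorem bd_cr_sum (S : Finset Site) (v : Site) (hv : v ∈ S) : ∑ e ∈ bdF S, cr v e = 1 := by
  obtain ⟨v1, v2⟩ := v
  obtain ⟨N, hN⟩ : ∃ N : ℕ, ∀ z ∈ S, z.1 < v1 + N := by
    refine ⟨∑ z ∈ S, (z.1 - v1 + 1).toNat, fun z hz => ?_⟩
    have := Finset.single_le_sum (f := fun z : Site => (z.1 - v1 + 1).toNat) (fun _ _ => Nat.zero_le _) hz
    omega
  set s : ℕ → ℤ := fun i => if ((v1 + i, v2) : Site) ∈ S then 1 else 0 with hs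
  set f1 : ℕ → DE := fun i => ((v1 + 1 + i, v2), 1) with hf1
  set f3 : ℕ → DE := fun i => ((v1 + 1 + i, v2 + 1), 3) with hf3
  have hd : Disjoint ((Finset.range N).image f1) ((Finset.range N).image f3) := by
    rw [Finset.disjoint_left]
    intro e h1 h2
    rw [Finset.mem_image] at h1 h2
    obtain ⟨i, _, rfl⟩ := h1
    obtain ⟨j, _, h⟩ := h2
    simp [hf1, hf3] at h
  have e1 : ∑ e ∈ bdF S, cr (v1, v2) e =
      ∑ e ∈ ((Finset.range N).image f1 ∪ (Finset.range N).image f3).filter (bd S), cr (v1, v2) e := by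
    symm
    refine Finset.sum_subset (fun e he => ?_) (fun e he hne => ?_)
    · rw [mem_bdF]; exact (Finset.mem_filter.1 he).2
    · rw [mem_bdF] at he
      by_contra hcr
      refine hne (Finset.mem_filter.2 ⟨?_, he⟩)
      obtain ⟨⟨a, b⟩, d⟩ := e
      have hl := hN _ he.1
      simp only [cr] at hcr
      rw [Finset.mem_union, Finset.mem_image, Finset.mem_image]
      by_cases hA : d = 1 ∧ b = v2 ∧ v1 < a
      · obtain ⟨rfl, rfl, h⟩ := hA
        left
        simp [lc, lo] at hl
        refine ⟨(a - v1 - 1).toNat, Finset.mem_range.2 (by omega), ?_⟩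
        simp only [hf1, Prod.mk.injEq, and_true]; omega
      · by_cases hB : d = 3 ∧ b = v2 + 1 ∧ v1 < a
        · obtain ⟨rfl, rfl, h⟩ := hB
          right
          simp [lc, lo] at hl
          refine ⟨(a - v1 - 1).toNat, Finset.mem_range.2 (by omega), ?_⟩
          simp only [hf3, Prod.mk.injEq, and_true]; omega
        · simp [hA, hB] at hcr
  rw [e1, Finset.sum_filter, Finset.sum_union hd, Finset.sum_image, Finset.sum_image, ← Finset.sum_add_distrib]
  · have : ∀ i ∈ Finset.range N, ((if bd S (f1 i) then cr (v1, v2) (f1 i) else 0) + if bd S (f3 i) then cr (v1, v2) (f3 i) else 0)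
        = s i - s (i + 1) := by
      intro i _
      have a1 : lc (f1 i) = (v1 + i, v2) := by simp [lc, lo, hf1]; ring
      have a2 : rc (f1 i) = (v1 + (i + 1 : ℕ), v2) := by simp [rc, ro, hf1]; ring
      have a3 : lc (f3 i) = (v1 + (i + 1 : ℕ), v2) := by simp [lc, lo, hf3]; ring
      have a4 : rc (f3 i) = (v1 + i, v2) := by simp [rc, ro, hf3]; ring
      have b1 : cr (v1, v2) (f1 i) = 1 := by simp [cr, hf1]; omega
      have b2 : cr (v1, v2) (f3 i) = -1 := by simp [cr, hf3]; omega
      simp only [bd, a1, a2, a3, a4, b1, b2, hs]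
      by_cases c1 : ((v1 + i, v2) : Site) ∈ S <;> by_cases c2 : ((v1 + (i + 1 : ℕ), v2) : Site) ∈ S <;> simp only [c1, c2] <;> simp
    rw [Finset.sum_congr rfl this, Finset.sum_range_sub']
    have : ((v1 + N, v2) : Site) ∉ S := fun h => by simpa using hN _ h
    simp [hs, hv, this]
  · intro i _ j _ h; simpa [hf3] using h
  · intro i _ j _ h; simpa [hf1] using h

/-! ### Existence of a separating cycle -/

def ce (v : Site) (γ : ℕ × List (Fin 4)) : List DE := edges (v.1 + 1 + γ.1, v.2) γ.2

def isCyc (v : Site) (γ : ℕ × List (Fin 4)) : Prop :=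
  vsum γ.2 = 0 ∧ γ.1 < γ.2.length ∧ (∃ r, γ.2 = 1 :: r ∧ saw r) ∧ (ce v γ).Nodup ∧ 0 < wind v (ce v γ)

theorem nx_iter (S : Finset Site) (e : DE) (n : ℕ) :
    edges e.1 ((List.range n).map (fun i => ((nx S)^[i] e).2)) = (List.range n).map (fun i => (nx S)^[i] e) ∧
    e.1 + vsum ((List.range n).map (fun i => ((nx S)^[i] e).2)) = ((nx S)^[n] e).1 := by
  induction n with
  | zero => simp [edges, vsum]
  | succ n ih =>
    rw [List.range_succ, List.map_append, List.map_append, edges_append, vsum_append, ih.1, ← add_assoc, ih.2]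
    constructor
    · simp [edges]
    · rw [Function.iterate_succ_apply']
      simp [vsum, nx]

def GoodW (S : Finset Site) (v : Site) (w : Site × List (Fin 4)) : Prop :=
  vsum w.2 = 0 ∧ (∀ e ∈ edges w.1 w.2, bd S e) ∧ 0 < wind v (edges w.1 w.2)

theorem exists_good (S : Finset Site) (v : Site) (hv : v ∈ S) : ∃ w, GoodW S v w := by
  set σf : {e // e ∈ bdF S} → {e // e ∈ bdF S} := fun e =>
    ⟨nx S e.1, (mem_bdF S _).2 (nx_bd S _ ((mem_bdF S _).1 e.2))⟩ with hσf
  have hinj : Function.Injective σf := by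
    intro a b h
    have h1 := congrArg (fun e => pv S e.1) h
    simp only [hσf] at h1
    rw [pv_nx S _ ((mem_bdF S _).1 a.2), pv_nx S _ ((mem_bdF S _).1 b.2)] at h1
    exact Subtype.ext h1
  set σ : Equiv.Perm {e // e ∈ bdF S} := Equiv.ofBijective σf (Finite.injective_iff_bijective.1 hinj) with hσ
  have hit : ∀ (i : ℕ) e, (((σ ^ i) e : {e // e ∈ bdF S}) : DE) = (nx S)^[i] e.1 := by
    intro i
    induction i with
    | zero => intro e; simp
    | succ i ih =>
      intro e
      rw [pow_succ, Equiv.Perm.mul_apply, ih, Function.iterate_succ_apply]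
      rfl
  set N := orderOf σ with hN
  have hNpos : 0 < N := orderOf_pos σ
  have hsum : ∑ x : {e // e ∈ bdF S}, ∑ i ∈ Finset.range N, cr v ((nx S)^[i] x.1) = N := by
    rw [Finset.sum_comm]
    have : ∀ i ∈ Finset.range N, ∑ x : {e // e ∈ bdF S}, cr v ((nx S)^[i] x.1) = 1 := by
      intro i _
      rw [← bd_cr_sum S v hv, ← Finset.sum_attach (bdF S), ← Finset.univ_eq_attach, ← Equiv.sum_comp (σ ^ i) (fun x => cr v x.1)]
      refine Finset.sum_congr rfl fun x _ => ?_
      rw [hit]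
    rw [Finset.sum_congr rfl this]; simp
  obtain ⟨x, -, hx⟩ : ∃ x ∈ (Finset.univ : Finset {e // e ∈ bdF S}), 0 < ∑ i ∈ Finset.range N, cr v ((nx S)^[i] x.1) := by
    apply Finset.exists_lt_of_sum_lt
    rw [hsum]; simpa using hNpos
  obtain ⟨h1, h2⟩ := nx_iter S x.1 N
  refine ⟨(x.1.1, (List.range N).map (fun i => ((nx S)^[i] x.1).2)), ?_, ?_, ?_⟩
  · rw [← hit N, hN, pow_orderOf_eq_one] at h2
    simpa using h2
  · rw [h1]
    intro e he
    rw [List.mem_map] at he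
    obtain ⟨i, _, rfl⟩ := he
    rw [← hit, ← mem_bdF]
    exact Subtype.property _
  · rw [h1]
    unfold wind lsum
    rw [List.map_map]
    have e : ∀ n, (List.map (cr v ∘ fun i => (nx S)^[i] x.1) (List.range n)).sum = ∑ i ∈ Finset.range n, cr v ((nx S)^[i] x.1) := by
      intro n
      induction n with
      | zero => simp
      | succ n ih => rw [List.range_succ, Finset.sum_range_succ, List.map_append, List.sum_append, ih]; simp
    rw [e]; exact hx

theorem vsum_bound (A : List (Fin 4)) : |(vsum A).1| ≤ A.length ∧ |(vsum A).2| ≤ A.length := by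
  induction A with
  | nil => simp [vsum]
  | cons d A ih =>
    rw [vsum_cons, List.length_cons]
    push_cast
    rw [abs_le, abs_le] at *
    fin_cases d <;> simp [dv, vx, vy] <;> omega

theorem nodup_cons_edges (d : Fin 4) (ds : List (Fin 4)) (p : Site) (h1 : (edges (p + dv d) ds).Nodup)
    (h : ∀ A C, ds = A ++ d :: C → vsum (d :: A) ≠ 0) : (edges p (d :: ds)).Nodup := by
  rw [edges, List.nodup_cons]
  refine ⟨fun hm => ?_, h1⟩
  obtain ⟨A, C, h2, h3⟩ := mem_edges _ _ _ hm
  refine h A C h2 ?_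
  rw [vsum_cons]
  simpa [add_assoc] using h3

theorem nodup_saw (ds : List (Fin 4)) : ∀ p, saw ds → (edges p ds).Nodup := by
  induction ds with
  | nil => intro p _; simp [edges]
  | cons d ds ih =>
    intro p h
    refine nodup_cons_edges d ds p (ih _ (saw_tail _ _ h)) ?_
    rintro A C rfl
    refine h _ ?_ (by simp)
    exact ⟨[], d :: C, by simp⟩

theorem exists_cyc (S : Finset Site) (v : Site) (hv : v ∈ S) : ∃ γ, isCyc v γ ∧ ∀ e ∈ ce v γ, bd S e := by
  have hex : ∃ n, ∃ w, GoodW S v w ∧ w.2.length = n := by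
    obtain ⟨w, hw⟩ := exists_good S v hv
    exact ⟨_, w, hw, rfl⟩
  obtain ⟨⟨p, ds⟩, ⟨hcl, hbd, hw⟩, hlen⟩ := Nat.find_spec hex
  have hmin : ∀ w, GoodW S v w → ds.length ≤ w.2.length := by
    intro w hw
    simp only at hlen
    rw [hlen]
    exact Nat.find_min' hex ⟨w, hw, rfl⟩
  clear hlen
  obtain ⟨⟨q, d⟩, he, hpos⟩ := lsum_pos_mem _ _ hw
  have hq : d = 1 ∧ q.2 = v.2 ∧ v.1 < q.1 := by
    by_contra hcon
    simp only [cr, hcon, if_false] at hpos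
    split_ifs at hpos <;> omega
  obtain ⟨A, C, hds, hqA⟩ := mem_edges _ _ _ he
  simp only at hds hqA
  have hd := hq.1
  subst hd
  simp only at hcl hbd hw hmin
  subst hds
  have hcl2 : vsum A + vsum (1 :: C) = 0 := by rw [← vsum_append]; exact hcl
  have hback : q + vsum (1 :: C) = p := by rw [hqA, add_assoc, hcl2, add_zero]
  have hperm : (edges q (1 :: C ++ A)).Perm (edges p (A ++ 1 :: C)) := by
    rw [edges_append, edges_append, hback, ← hqA]
    exact List.perm_append_comm
  have hW : wind v (edges q (1 :: C ++ A)) = wind v (edges p (A ++ 1 :: C)) := (hperm.map _).sum_eq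
  have hg : vsum (1 :: C ++ A) = 0 := by rw [vsum_append, add_comm]; exact hcl2
  have hlen : (1 :: C ++ A).length = (A ++ 1 :: C).length := by simp; omega
  have hbd2 : ∀ e ∈ edges q (1 :: C ++ A), bd S e := fun e he => hbd e (hperm.mem_iff.1 he)
  have hw2 : 0 < wind v (edges q (1 :: C ++ A)) := by rw [hW]; exact hw
  rw [← hlen] at hmin
  clear hlen hW hperm hback hcl2 hw hbd hcl he hpos
  have hq2 := hq.2
  clear hq hqA
  rw [List.cons_append] at *
  generalize C ++ A = r at *
  -- no proper closed sub-walk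
  have hsub : ∀ B, B <:+: (1 :: r) → B ≠ [] → B.length ≠ (1 :: r).length → vsum B ≠ 0 := by
    rintro B ⟨X, Y, hXY⟩ hne hlen hB
    have hl : X.length + B.length + Y.length = (1 :: r).length := by rw [← hXY]; simp [add_assoc]
    have hBpos : 0 < B.length := List.length_pos_of_ne_nil hne
    have hE : edges q (1 :: r) = edges q X ++ edges (q + vsum X) B ++ edges (q + vsum X) Y := by
      rw [← hXY, edges_append, edges_append, vsum_append, hB, add_zero]
    have hE2 : edges q (X ++ Y) = edges q X ++ edges (q + vsum X) Y := edges_append _ _ _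
    have hwd : wind v (edges q (1 :: r)) = wind v (edges (q + vsum X) B) + wind v (edges q (X ++ Y)) := by
      rw [hE, hE2]; simp only [wind, lsum_append]; ring
    have hXY0 : vsum (X ++ Y) = 0 := by
      rw [← hXY, vsum_append, vsum_append, hB, add_zero, ← vsum_append] at hg; exact hg
    by_cases h1 : 0 < wind v (edges (q + vsum X) B)
    · have := hmin (q + vsum X, B) ⟨hB, fun e he => hbd2 e (by rw [hE]; simp only at he; simp [he]), h1⟩
      simp only at this
      omega
    · have := hmin (q, X ++ Y) ⟨hXY0, fun e he => hbd2 e (by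
        simp only at he
        rw [hE2, List.mem_append] at he; rw [hE]; simp only [List.mem_append]; tauto), by simp only; omega⟩
      simp only [List.length_append] at this
      omega
  have hsaw : saw r := by
    intro B hB hne
    refine hsub B (hB.trans ⟨[1], [], by simp⟩) hne ?_
    have := hB.length_le
    simp; omega
  obtain ⟨q1, q2⟩ := q
  obtain ⟨v1, v2⟩ := v
  obtain ⟨rfl, hlt⟩ := hq2
  simp only at hlt
  have hqeq : q1 = v1 + 1 + ((q1 - v1 - 1).toNat : ℤ) := by omega
  refine ⟨((q1 - v1 - 1).toNat, 1 :: r), ⟨hg, ?_, ⟨r, rfl, hsaw⟩, ?_, ?_⟩, ?_⟩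
  · by_contra hcon
    simp only [not_lt] at hcon
    have : wind (v1, q2) (edges (q1, q2) (1 :: r)) = 0 := by
      unfold wind
      rw [lsum_tele _ (fun z => if q2 < z.2 then 1 else 0), hg]
      · simp
      · rintro ⟨⟨a, b⟩, d⟩ he
        obtain ⟨X, Y, h1, h2⟩ := mem_edges _ _ _ he
        have h3 := (vsum_bound X).1
        have h4 : X.length < (1 :: r).length := by rw [h1]; simp
        rw [abs_le] at h3
        have h5 := congrArg Prod.fst h2
        simp only [Prod.fst_add] at h5
        have h6 : v1 < a := by omega
        clear h1 h2 he
        fin_cases d <;> simp [cr, dv, vx, vy, h6] <;> grind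
    exact absurd this hw2.ne'
  · simp only [ce]
    rw [← hqeq]
    refine nodup_cons_edges _ _ _ (nodup_saw _ _ hsaw) ?_
    rintro X Y rfl
    refine hsub _ ⟨[], 1 :: Y, by simp⟩ (by simp) (by simp)
  · simp only [ce]
    rw [← hqeq]; exact hw2
  · simp only [ce]
    rw [← hqeq]; exact hbd2

/-! ### Length bounds and energy of cycles -/

theorem counts (ds : List (Fin 4)) : vsum ds = ((ds.count 0 : ℤ) - ds.count 2, (ds.count 1 : ℤ) - ds.count 3) ∧
    ds.length = ds.count 0 + ds.count 1 + ds.count 2 + ds.count 3 := by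
  induction ds with
  | nil => simp [vsum]; rfl
  | cons d ds ih =>
    rw [vsum_cons, ih.1, List.length_cons, ih.2]
    fin_cases d <;> simp [dv, vx, vy, List.count_cons] <;> omega

theorem filter_count (ds : List (Fin 4)) (d : Fin 4) : ∀ p, ((edges p ds).filter (fun e => e.2 = d)).length = ds.count d := by
  induction ds with
  | nil => intro p; simp [edges]
  | cons c ds ih =>
    intro p
    rw [edges, List.filter_cons, List.count_cons]
    by_cases h : c = d
    · simp [h, ih]
    · simp [h, ih]

theorem one_le_count (ds : List (Fin 4)) (p) (e : DE) (he : e ∈ edges p ds) : 1 ≤ ds.count e.2 := by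
  rw [← filter_count ds e.2 p]
  refine List.length_pos_of_mem (a := e) ?_
  simp [he]

theorem two_le_count (ds : List (Fin 4)) (p) (e f : DE) (he : e ∈ edges p ds) (hf : f ∈ edges p ds) (h : e.2 = f.2)
    (hne : e ≠ f) : 2 ≤ ds.count e.2 := by
  rw [← filter_count ds e.2 p]
  refine le_trans ?_ (List.toFinset_card_le _)
  rw [← Finset.card_pair hne]
  refine Finset.card_le_card ?_
  intro x hx
  rw [Finset.mem_insert, Finset.mem_singleton] at hx
  rcases hx with rfl | rfl
  · simp [he]
  · simp [hf, h]

theorem wind_N (x : Site) (L) (h : 0 < wind x L) : ∃ e ∈ L, e.2 = 1 ∧ e.1.2 = x.2 := by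
  obtain ⟨e, he, hp⟩ := lsum_pos_mem _ _ h
  refine ⟨e, he, ?_⟩
  unfold cr at hp
  by_contra hcon
  split_ifs at hp <;> omega

theorem wind_W (x : Site) (p ds) (hc : vsum ds = 0) (h : 0 < wind x (edges p ds)) : ∃ e ∈ edges p ds, e.2 = 2 ∧ e.1.1 = x.1 + 1 := by
  rw [wind_eq_cu x p ds hc] at h
  obtain ⟨e, he, hp⟩ := lsum_pos_mem _ _ h
  refine ⟨e, he, ?_⟩
  unfold cu at hp
  by_contra hcon
  split_ifs at hp <;> omega

theorem len6 (v u : Site) (hu : u ∈ nbrs v) (p ds) (hc : vsum ds = 0) (h1 : 0 < wind v (edges p ds))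
    (h2 : 0 < wind u (edges p ds)) : 6 ≤ ds.length := by
  obtain ⟨hv, hl⟩ := counts ds
  rw [hc] at hv
  have hv1 := congrArg Prod.fst hv
  have hv2 := congrArg Prod.snd hv
  simp only [Prod.fst_zero, Prod.snd_zero] at hv1 hv2
  obtain ⟨e1, he1, hd1, hr1⟩ := wind_N v _ h1
  obtain ⟨e2, he2, hd2, hr2⟩ := wind_N u _ h2
  obtain ⟨f1, hf1, hc1, hs1⟩ := wind_W v _ _ hc h1
  obtain ⟨f2, hf2, hc2, hs2⟩ := wind_W u _ _ hc h2
  have a := one_le_count _ _ _ he1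
  have b := one_le_count _ _ _ hf1
  have a2 := two_le_count _ _ _ _ he1 he2 (by rw [hd1, hd2])
  have b2 := two_le_count _ _ _ _ hf1 hf2 (by rw [hc1, hc2])
  rw [hd1] at a a2
  rw [hc1] at b b2
  have hne : e1 ≠ e2 ∨ f1 ≠ f2 := by
    by_contra! hcon
    obtain ⟨rfl, rfl⟩ := hcon
    refine nbrs_ne _ _ hu ?_
    ext <;> omega
  rcases hne with h | h
  · have := a2 h; omega
  · have := b2 h; omega

theorem us_nonneg (x y L) : 0 ≤ us x y L := by
  unfold us lsum
  refine List.sum_nonneg ?_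
  intro a ha
  rw [List.mem_map] at ha
  obtain ⟨e, _, rfl⟩ := ha
  unfold ui; split_ifs <;> norm_num

theorem us_eq_zero (x y L) (h : ∀ e ∈ L, ¬ (lc e = x ∧ rc e = y)) : us x y L = 0 := by
  unfold us
  induction L with
  | nil => rfl
  | cons a L ih =>
    rw [lsum_cons, ih (fun e he => h e (by simp [he])), ui, if_neg (h a (by simp))]; rfl

theorem lcrc_inj (e f : DE) (h1 : lc e = lc f) (h2 : rc e = rc f) : e = f := by
  obtain ⟨⟨a, b⟩, d⟩ := e
  obtain ⟨⟨a', b'⟩, d'⟩ := f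
  simp only [lc, rc] at h1 h2
  fin_cases d <;> fin_cases d' <;> simp [lo, ro, Prod.ext_iff] at h1 h2 ⊢ <;> omega

theorem us_le_one (x y L) (hL : L.Nodup) : us x y L ≤ 1 := by
  induction L with
  | nil => simp [us, lsum]
  | cons a L ih =>
    rw [List.nodup_cons] at hL
    have := ih hL.2
    by_cases h : lc a = x ∧ rc a = y
    · have h0 : us x y L = 0 := by
        refine us_eq_zero x y L fun e he hh => hL.1 ?_
        rw [lcrc_inj a e (by rw [h.1, hh.1]) (by rw [h.2, hh.2])]; exact he
      unfold us at *
      rw [lsum_cons, h0, ui]; simp [h]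
    · unfold us at *
      rw [lsum_cons, ui, if_neg h]; omega

theorem rc_nbr (e : DE) : rc e ∈ nbrs (lc e) := by
  obtain ⟨⟨a, b⟩, d⟩ := e
  fin_cases d <;> simp [lc, rc, lo, ro, nbrs, Prod.ext_iff] <;> omega

theorem us_total (Λ : Finset Site) (L : List DE) (h : ∀ e ∈ L, lc e ∈ Λ) :
    ∑ x ∈ Λ, ∑ y ∈ nbrs x, us x y L = L.length := by
  induction L with
  | nil => simp [us, lsum]
  | cons a L ih =>
    have : ∀ x y, us x y (a :: L) = ui x y a + us x y L := fun x y => lsum_cons _ _ _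
    simp only [this, Finset.sum_add_distrib, ih (fun e he => h e (by simp [he]))]
    have h1 : ∑ x ∈ Λ, ∑ y ∈ nbrs x, ui x y a = 1 := by
      rw [Finset.sum_eq_single (lc a)]
      · rw [Finset.sum_eq_single (rc a)]
        · simp [ui]
        · intro y _ hy; simp [ui, hy.symm]
        · intro hh; exact absurd (rc_nbr a) hh
      · intro x _ hx; simp [ui, hx.symm]
      · intro hh; exact absurd (h a (by simp)) hh
    rw [h1]; simp; ring

theorem wind_abs (x L) : |wind x L| ≤ (L.length : ℤ) := by
  unfold wind
  induction L with
  | nil => simp [lsum]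
  | cons a L ih =>
    rw [lsum_cons, List.length_cons]
    have h1 : |cr x a| ≤ 1 := by unfold cr; split_ifs <;> simp
    push_cast
    have := abs_add_le (cr x a) (lsum (cr x) L)
    linarith

/-- edge of the level set `{η ≥ k + 1}` -/
def bdl (η : Config) (k : ℕ) (e : DE) : Prop := (k : ℤ) + 1 ≤ η (lc e) ∧ η (rc e) ≤ k

def Wf (v : Site) (M : ℕ) (γ : ℕ → ℕ × List (Fin 4)) : Config := fun x => ∑ k ∈ Finset.range M, wind x (ce v (γ k))

theorem card_levels (M : ℕ) (a b : ℤ) (h : b ≤ a) :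
    (((Finset.range M).filter (fun k : ℕ => b ≤ k ∧ (k:ℤ) + 1 ≤ a)).card : ℤ) ≤ a - b := by
  have : ((Finset.range M).filter (fun k : ℕ => b ≤ k ∧ (k:ℤ) + 1 ≤ a)).card ≤ (Finset.Ico b a).card := by
    refine Finset.card_le_card_of_injOn (fun k : ℕ => (k : ℤ)) ?_ ?_
    · intro k hk
      have := (Finset.mem_filter.1 hk).2
      exact Finset.mem_coe.2 (Finset.mem_Ico.2 ⟨this.1, by simp only; omega⟩)
    · intro a _ b _ h; simpa using h
  rw [Int.card_Ico] at this
  omega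

theorem level_us (η : Config) (v : Site) (M : ℕ) (γ : ℕ → ℕ × List (Fin 4))
    (hn : ∀ k < M, (ce v (γ k)).Nodup) (hb : ∀ k < M, ∀ e ∈ ce v (γ k), bdl η k e) (x y : Site) (hxy : η y ≤ η x) :
    ∑ k ∈ Finset.range M, us y x (ce v (γ k)) = 0 ∧ ∑ k ∈ Finset.range M, us x y (ce v (γ k)) ≤ η x - η y := by
  constructor
  · refine Finset.sum_eq_zero fun k hk => us_eq_zero _ _ _ fun e he hh => ?_
    have := hb k (Finset.mem_range.1 hk) e he
    unfold bdl at this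
    rw [hh.1, hh.2] at this
    omega
  · refine le_trans ?_ (card_levels M _ _ hxy)
    rw [Finset.card_filter]
    push_cast
    refine Finset.sum_le_sum fun k hk => ?_
    split_ifs with h
    · exact us_le_one _ _ _ (hn k (Finset.mem_range.1 hk))
    · refine le_of_eq (us_eq_zero _ _ _ fun e he hh => h ?_)
      have := hb k (Finset.mem_range.1 hk) e he
      unfold bdl at this
      rw [hh.1, hh.2] at this
      omega

theorem energy (Λ : Finset Site) (η : Config) (hη : ∀ x, x ∉ Λ → η x = 0) (v : Site) (M : ℕ) (γ : ℕ → ℕ × List (Fin 4))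
    (hc : ∀ k < M, vsum (γ k).2 = 0)
    (hn : ∀ k < M, (ce v (γ k)).Nodup) (hb : ∀ k < M, ∀ e ∈ ce v (γ k), bdl η k e) :
    en Λ (η - Wf v M γ) + ((∑ k ∈ Finset.range M, (γ k).2.length : ℕ) : ℝ) ≤ en Λ η := by
  set U : Site → Site → ℤ := fun x y => ∑ k ∈ Finset.range M, us x y (ce v (γ k)) with hU
  have htot : ∑ x ∈ Λ, ∑ y ∈ nbrs x, (U x y : ℝ) = ((∑ k ∈ Finset.range M, (γ k).2.length : ℕ) : ℝ) := by
    have : ∑ x ∈ Λ, ∑ y ∈ nbrs x, U x y = ((∑ k ∈ Finset.range M, (γ k).2.length : ℕ) : ℤ) := by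
      simp only [hU]
      have e1 : ∀ x ∈ Λ, ∑ y ∈ nbrs x, ∑ k ∈ Finset.range M, us x y (ce v (γ k)) = ∑ k ∈ Finset.range M, ∑ y ∈ nbrs x, us x y (ce v (γ k)) :=
        fun x _ => Finset.sum_comm
      rw [Finset.sum_congr rfl e1, Finset.sum_comm]
      push_cast
      refine Finset.sum_congr rfl fun k hk => ?_
      rw [us_total Λ, ce, edges_length]
      intro e he
      by_contra hcon
      have := (hb k (Finset.mem_range.1 hk) e he).1
      rw [hη _ hcon] at this
      omega
    exact_mod_cast this
  rw [← htot]
  refine en_add_le Λ η _ (fun x y => (U x y : ℝ)) ?_ ?_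
  · intro x y hx
    have : U x y = 0 := by
      refine Finset.sum_eq_zero fun k hk => us_eq_zero _ _ _ fun e he hh => ?_
      have := (hb k (Finset.mem_range.1 hk) e he).1
      rw [hh.1, hη _ hx] at this
      omega
    simp [this]
  · intro x hx y hy
    have hg : Wf v M γ x - Wf v M γ y = U x y - U y x := by
      simp only [Wf, hU, ← Finset.sum_sub_distrib]
      refine Finset.sum_congr rfl fun k hk => ?_
      exact grad x y hy _ _ (hc k (Finset.mem_range.1 hk))
    have key : |(η - Wf v M γ) x - (η - Wf v M γ) y| + (U x y + U y x) ≤ |η x - η y| := by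
      simp only [Pi.sub_apply]
      rcases le_total (η y) (η x) with h | h
      · obtain ⟨h1, h2⟩ := level_us η v M γ hn hb x y h
        change U y x = 0 at h1
        change U x y ≤ _ at h2
        rw [abs_of_nonneg (by omega), abs_of_nonneg (by omega)]; omega
      · obtain ⟨h1, h2⟩ := level_us η v M γ hn hb y x h
        change U x y = 0 at h1
        change U y x ≤ _ at h2
        rw [abs_of_nonpos (by omega), abs_of_nonpos (by omega)]; omega
    exact_mod_cast key

theorem PE_cycles (β : ℝ) (hβ : 0 < β) (Λ : Finset Site) (v : Site) (M : ℕ) (γ : ℕ → ℕ × List (Fin 4))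
    (hγ : ∀ k < M, isCyc v (γ k)) (A : Set Config) (hA : ∀ η ∈ A, ∀ k < M, ∀ e ∈ ce v (γ k), bdl η k e) :
    PE β Λ A ≤ ENNReal.ofReal (Real.exp (-β * ((∑ k ∈ Finset.range M, (γ k).2.length : ℕ) : ℝ))) * ZE β Λ 0 := by
  refine (PE_shift β Λ (Wf v M γ) A Set.univ (ENNReal.ofReal (Real.exp (-β * ((∑ k ∈ Finset.range M, (γ k).2.length : ℕ) : ℝ)))) ?_).trans ?_
  · intro g hg
    refine ⟨Set.mem_univ _, wt_le β hβ Λ _ _ _ ?_⟩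
    refine energy Λ _ ?_ v M γ (fun k hk => (hγ k hk).1) (fun k hk => (hγ k hk).2.2.2.1) (hA _ hg)
    intro x hx
    simp [extendC, hx]
  · refine mul_le_mul_right ?_ _
    simp only [Set.indicator_univ]
    refine ZE_le_zero β hβ Λ _ (∑ k ∈ Finset.range M, (γ k).2.length) ?_
    intro x
    rw [Pi.neg_apply, abs_neg, Wf]
    refine (Finset.abs_sum_le_sum_abs _ _).trans ?_
    push_cast
    refine Finset.sum_le_sum fun k _ => ?_
    have := wind_abs x (ce v (γ k))
    rwa [ce, edges_length] at this

/-! ### Peierls estimate -/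

theorem cyc_level (Λ : Finset Site) (η : Config) (hη : ∀ x, x ∉ Λ → η x = 0) (v u : Site) (hu : u ∈ nbrs v) (M k : ℕ)
    (hk : k < M) (h1 : (M:ℤ) ≤ η v) (h2 : (M:ℤ) ≤ η u) :
    ∃ γ, isCyc v γ ∧ (∀ e ∈ ce v γ, bdl η k e) ∧ 6 ≤ γ.2.length ∧ γ.2.length ≤ 4 * Λ.card := by
  set S := Λ.filter (fun x => (k:ℤ) + 1 ≤ η x) with hS
  have hmem : ∀ x, x ∈ S ↔ (k:ℤ) + 1 ≤ η x := by
    intro x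
    rw [hS, Finset.mem_filter, and_iff_right_iff_imp]
    intro h
    by_contra hx
    rw [hη x hx] at h; omega
  have hvS : v ∈ S := by rw [hmem]; omega
  have huS : u ∈ S := by rw [hmem]; omega
  obtain ⟨γ, hγ, hbd⟩ := exists_cyc S v hvS
  refine ⟨γ, hγ, ?_, ?_, ?_⟩
  · intro e he
    have h := hbd e he
    unfold bd at h
    rw [hmem, hmem] at h
    exact ⟨h.1, by omega⟩
  · refine len6 v u hu (v.1 + 1 + γ.1, v.2) _ hγ.1 hγ.2.2.2.2 ?_
    have hg := grad v u hu (v.1 + 1 + γ.1, v.2) γ.2 hγ.1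
    rw [us_eq_zero v u, us_eq_zero u v] at hg
    · have := hγ.2.2.2.2
      unfold ce at this
      omega
    · intro e he hh
      have := (hbd e he).2
      rw [hh.2] at this; exact this hvS
    · intro e he hh
      have := (hbd e he).2
      rw [hh.2] at this; exact this huS
  · have : (ce v γ).toFinset.card ≤ (bdF S).card := by
      refine Finset.card_le_card fun e he => ?_
      rw [mem_bdF]; exact hbd e (List.mem_toFinset.1 he)
    rw [List.toFinset_card_of_nodup hγ.2.2.2.1, ce, edges_length] at this
    have h3 := bdF_card S
    have h4 : S.card ≤ Λ.card := Finset.card_filter_le _ _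
    omega

def bx (n0 : ℕ) (v : Site) : Finset Site :=
  (Finset.Icc (v.1 - (2 * n0 + 2 : ℕ)) (v.1 + (2 * n0 + 2 : ℕ))) ×ˢ (Finset.Icc (v.2 - (2 * n0 + 2 : ℕ)) (v.2 + (2 * n0 + 2 : ℕ)))

theorem bx_card (n0 v) : (bx n0 v).card = (4 * n0 + 5) ^ 2 := by
  unfold bx
  rw [Finset.card_product, Int.card_Icc, Int.card_Icc, sq]
  congr 1 <;> omega

theorem small_box (n0 : ℕ) (v : Site) (γ) (hγ : isCyc v γ) (hn : γ.2.length < n0) (e) (he : e ∈ ce v γ) :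
    lc e ∈ bx n0 v ∧ rc e ∈ bx n0 v := by
  obtain ⟨A, C, h1, h2⟩ := mem_edges _ _ _ he
  have h3 := hγ.2.1
  have h4 := vsum_bound A
  rw [abs_le, abs_le] at h4
  have h5 : A.length < γ.2.length := by rw [h1]; simp
  have h6 : (lo e.2).1 ≤ 0 ∧ -1 ≤ (lo e.2).1 ∧ (lo e.2).2 ≤ 0 ∧ -1 ≤ (lo e.2).2 := by
    generalize e.2 = d; fin_cases d <;> simp [lo]
  have h7 : (ro e.2).1 ≤ 0 ∧ -1 ≤ (ro e.2).1 ∧ (ro e.2).2 ≤ 0 ∧ -1 ≤ (ro e.2).2 := by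
    generalize e.2 = d; fin_cases d <;> simp [ro]
  simp only [bx, Finset.mem_product, Finset.mem_Icc, lc, rc, h2, Prod.fst_add, Prod.snd_add]
  push_cast
  omega

def clampN (M : ℕ) (z : ℤ) : Fin (M + 1) := ⟨min z.toNat M, by omega⟩

theorem clamp_bdl (M k : ℕ) (hk : k < M) (η ζ : Config) (e : DE) (h1 : clampN M (η (lc e)) = clampN M (ζ (lc e)))
    (h2 : clampN M (η (rc e)) = clampN M (ζ (rc e))) (h : bdl η k e) : bdl ζ k e := by
  unfold bdl at *
  simp only [clampN, Fin.mk.injEq] at h1 h2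
  omega

def Lgn (n : ℕ) : Finset (ℕ × List (Fin 4)) := (Finset.range n) ×ˢ ((sawF (n - 1)).image (fun r => 1 :: r))

theorem mem_Lgn (v γ) (hγ : isCyc v γ) : γ ∈ Lgn γ.2.length := by
  obtain ⟨r, hr, hs⟩ := hγ.2.2.1
  unfold Lgn
  rw [Finset.mem_product, Finset.mem_range, Finset.mem_image]
  refine ⟨hγ.2.1, r, ?_, hr.symm⟩
  rw [mem_sawF, hr]
  exact ⟨by simp, hs⟩

theorem Lgn_len (n : ℕ) (γ) (h : γ ∈ Lgn n) : γ.2.length = n := by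
  unfold Lgn at h
  rw [Finset.mem_product, Finset.mem_range, Finset.mem_image] at h
  obtain ⟨h1, r, hr, h2⟩ := h
  rw [mem_sawF] at hr
  rw [← h2, List.length_cons, hr.1]; omega

theorem Lgn_card (n : ℕ) : (Lgn n).card ≤ n * (sawF (n - 1)).card := by
  unfold Lgn
  rw [Finset.card_product, Finset.card_range]
  exact Nat.mul_le_mul_left _ Finset.card_image_le

def Lg (n0 m : ℕ) : Finset (ℕ × List (Fin 4)) := (Finset.Ico n0 (m + 1)).biUnion Lgn

def wo (β : ℝ) : Option (ℕ × List (Fin 4)) → ENNReal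
  | none => ENNReal.ofReal (Real.exp (-β * 6))
  | some γ => ENNReal.ofReal (Real.exp (-β * γ.2.length))

/-- the event attached to clamped data `c` in the box and a choice of large cycles `L` -/
def ev (n0 : ℕ) (v : Site) (M : ℕ) (c : {x // x ∈ bx n0 v} → Fin (M + 1)) (L : Fin M → Option (ℕ × List (Fin 4))) :
    Set Config :=
  {η | (∀ x, clampN M (η x.1) = c x) ∧ ∀ k : Fin M, (∀ γ, L k = some γ → isCyc v γ ∧ ∀ e ∈ ce v γ, bdl η k e) ∧
    (L k = none → ∃ γ, isCyc v γ ∧ (∀ e ∈ ce v γ, bdl η k e) ∧ 6 ≤ γ.2.length ∧ γ.2.length < n0)}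

theorem ev_bound (β : ℝ) (hβ : 0 < β) (Λ n0 v M c L) : PE β Λ (ev n0 v M c L) ≤ (∏ k, wo β (L k)) * ZE β Λ 0 := by
  by_cases hne : ∃ η0, η0 ∈ ev n0 v M c L
  · obtain ⟨η0, h0⟩ := hne
    have hch : ∀ k : ℕ, ∃ γ, ∀ hk : k < M, isCyc v γ ∧ (∀ η ∈ ev n0 v M c L, ∀ e ∈ ce v γ, bdl η k e) ∧
        ENNReal.ofReal (Real.exp (-β * γ.2.length)) ≤ wo β (L ⟨k, hk⟩) := by
      intro k
      by_cases hk : k < M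
      · rcases hL : L ⟨k, hk⟩ with _ | γ
        · obtain ⟨γ, g1, g2, g3, g4⟩ := (h0.2 ⟨k, hk⟩).2 hL
          refine ⟨γ, fun _ => ⟨g1, ?_, ?_⟩⟩
          · intro η hη e he
            obtain ⟨b1, b2⟩ := small_box n0 v γ g1 g4 e he
            refine clamp_bdl M k hk η0 η e ?_ ?_ (g2 e he)
            · rw [h0.1 ⟨_, b1⟩, hη.1 ⟨_, b1⟩]
            · rw [h0.1 ⟨_, b2⟩, hη.1 ⟨_, b2⟩]
          · rw [hL]
            refine ENNReal.ofReal_le_ofReal (Real.exp_le_exp.2 ?_)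
            have : (6:ℝ) ≤ γ.2.length := by exact_mod_cast g3
            nlinarith
        · refine ⟨γ, fun _ => ⟨((h0.2 ⟨k, hk⟩).1 γ hL).1, ?_, ?_⟩⟩
          · intro η hη
            exact ((hη.2 ⟨k, hk⟩).1 γ hL).2
          · rw [hL]; exact le_rfl
      · exact ⟨(0, []), fun h => absurd h hk⟩
    choose γ hγ using hch
    refine (PE_cycles β hβ Λ v M γ (fun k hk => (hγ k hk).1) _ (fun η hη k hk => (hγ k hk).2.1 η hη)).trans ?_
    refine mul_le_mul_left ?_ _
    push_cast
    rw [Finset.mul_sum, Real.exp_sum, ENNReal.ofReal_prod_of_nonneg (fun _ _ => Real.exp_nonneg _), Finset.prod_range]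
    exact Finset.prod_le_prod' fun k _ => (hγ k k.2).2.2
  · have : ev n0 v M c L = ∅ := by
      ext η; simp only [Set.mem_empty_iff_false, iff_false]; exact fun h => hne ⟨η, h⟩
    rw [this]; simp [PE]

def Ig (n0 m : ℕ) : Finset (Option (ℕ × List (Fin 4))) := insert none ((Lg n0 m).image some)

theorem Q_cover (Λ : Finset Site) (n0 : ℕ) (v u : Site) (hu : u ∈ nbrs v) (M : ℕ) (η : Config) (h1 : (M:ℤ) ≤ η v)
    (h2 : (M:ℤ) ≤ η u) (h3 : ∀ x, x ∉ Λ → η x = 0) :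
    ∃ L : Fin M → Option (ℕ × List (Fin 4)), (∀ k, L k ∈ Ig n0 (4 * Λ.card)) ∧
      η ∈ ev n0 v M (fun x => clampN M (η x.1)) L := by
  have hch : ∀ k : Fin M, ∃ o ∈ Ig n0 (4 * Λ.card), (∀ γ, o = some γ → isCyc v γ ∧ ∀ e ∈ ce v γ, bdl η k e) ∧
    (o = none → ∃ γ, isCyc v γ ∧ (∀ e ∈ ce v γ, bdl η k e) ∧ 6 ≤ γ.2.length ∧ γ.2.length < n0) := by
    intro k
    obtain ⟨γ, g1, g2, g3, g4⟩ := cyc_level Λ η h3 v u hu M k k.2 h1 h2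
    by_cases hs : γ.2.length < n0
    · exact ⟨none, by simp [Ig], by simp, fun _ => ⟨γ, g1, g2, g3, hs⟩⟩
    · refine ⟨some γ, ?_, ?_, by simp⟩
      · rw [Ig, Finset.mem_insert, Finset.mem_image]
        refine Or.inr ⟨γ, ?_, rfl⟩
        rw [Lg, Finset.mem_biUnion]
        exact ⟨γ.2.length, by rw [Finset.mem_Ico]; omega, mem_Lgn v γ g1⟩
      · intro γ' h
        obtain rfl := Option.some.inj h
        exact ⟨g1, g2⟩
  choose L hL1 hL2 using hch
  exact ⟨L, hL1, fun _ => rfl, hL2⟩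

theorem Q_bound (β : ℝ) (hβ : 0 < β) (Λ : Finset Site) (n0 : ℕ) (v u : Site) (hu : u ∈ nbrs v) (M : ℕ) :
    PE β Λ {η | (M:ℤ) ≤ η v ∧ (M:ℤ) ≤ η u} ≤
      ((M + 1 : ℕ) : ENNReal) ^ ((4 * n0 + 5) ^ 2) * (wo β none + ∑ γ ∈ Lg n0 (4 * Λ.card), wo β (some γ)) ^ M * ZE β Λ 0 := by
  set I : Finset (Option (ℕ × List (Fin 4))) := Ig n0 (4 * Λ.card) with hI
  have hcov : PE β Λ {η | ((M:ℤ) ≤ η v ∧ (M:ℤ) ≤ η u) ∧ ∀ x, x ∉ Λ → η x = 0} ≤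
      ∑ z ∈ (Finset.univ : Finset ({x // x ∈ bx n0 v} → Fin (M + 1))) ×ˢ Fintype.piFinset (fun _ : Fin M => I),
        PE β Λ (ev n0 v M z.1 z.2) := by
    generalize hP : (Finset.univ : Finset ({x // x ∈ bx n0 v} → Fin (M + 1))) ×ˢ Fintype.piFinset (fun _ : Fin M => I) = P
    apply PE_sUnion β Λ P _ (fun z => ev n0 v M z.1 z.2)
    intro η hη
    obtain ⟨L, hL1, hL2⟩ := Q_cover Λ n0 v u hu M η hη.1.1 hη.1.2 hη.2
    refine ⟨(fun x => clampN M (η x.1), L), ?_, hL2⟩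
    rw [← hP, Finset.mem_product]
    exact ⟨Finset.mem_univ _, Fintype.mem_piFinset.2 hL1⟩
  have heq : PE β Λ {η | (M:ℤ) ≤ η v ∧ (M:ℤ) ≤ η u} = PE β Λ {η | ((M:ℤ) ≤ η v ∧ (M:ℤ) ≤ η u) ∧ ∀ x, x ∉ Λ → η x = 0} := by
    unfold PE
    refine tsum_congr fun g => ?_
    have : ∀ x, x ∉ Λ → extendC Λ 0 g x = 0 := by intro x hx; simp [extendC, hx]
    simp only [Set.indicator_apply, Set.mem_ofPred_eq]
    exact if_congr (and_iff_left this).symm rfl rfl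
  rw [heq]
  refine hcov.trans ((Finset.sum_le_sum fun z _ => ev_bound β hβ Λ n0 v M z.1 z.2).trans ?_)
  rw [← Finset.sum_mul, Finset.sum_product]
  refine mul_le_mul_left ?_ _
  simp only
  rw [Finset.sum_const, nsmul_eq_mul, Finset.card_univ, Fintype.card_fun, Fintype.card_fin, Fintype.card_coe, bx_card,
    ← Finset.prod_univ_sum, Finset.prod_const, Finset.card_univ, Fintype.card_fin]
  push_cast
  refine mul_le_mul_right ?_ _
  refine pow_le_pow_left' ?_ _
  rw [hI, Ig, Finset.sum_insert (by simp), Finset.sum_image (by simp)]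

/-! ### Assembly -/

theorem tail_gen (f : ℕ → ℝ) (hsum : Summable f) : ∃ n0 : ℕ, 5 ≤ n0 ∧ ∀ m,
    ∑ n ∈ Finset.Ico n0 (m+1), f n ≤ 1 := by
  obtain ⟨s, hs⟩ := summable_iff_vanishing_norm.1 hsum 1 one_pos
  obtain ⟨N, hN⟩ : ∃ N, ∀ n ∈ s, n ≤ N := ⟨s.sup id, fun n hn => Finset.le_sup (f := id) hn⟩
  refine ⟨5 + (N + 1), Nat.le_add_right _ _, fun m => ?_⟩
  have hd : Disjoint (Finset.Ico (5 + (N + 1)) (m+1)) s := by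
    rw [Finset.disjoint_left]
    intro n hn hns
    have h1 := (Finset.mem_Ico.1 hn).1
    have h2 := hN n hns
    omega
  have h9 := hs _ hd
  rw [Real.norm_eq_abs] at h9
  exact (le_abs_self _).trans h9.le

theorem geo_sum (D r : ℝ) (hr0 : 0 < r) (hr1 : r < 1) : Summable (fun n : ℕ => D * ((n:ℝ)^1 * r^n)) := by
  have h0 : ‖r‖ < 1 := by rw [Real.norm_eq_abs, abs_of_pos hr0]; exact hr1
  have h := summable_pow_mul_geometric_of_norm_lt_one (R := ℝ) 1 h0
  exact Summable.mul_left D h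

theorem tail_sum (C : ℝ) (hC : 0 < C) : ∃ n0 : ℕ, 5 ≤ n0 ∧ ∀ m,
    ∑ n ∈ Finset.Ico n0 (m+1), (C * Real.exp 5 / (1359/500)) * ((n:ℝ)^1 * ((1359/500) * Real.exp (-1))^n) ≤ 1 := by
  have hr0 : 0 < (1359/500) * Real.exp (-1) := by positivity
  have hr1 : (1359/500) * Real.exp (-1) < 1 := by
    have h1 := Real.exp_one_gt_d9
    have h2 : Real.exp 1 * Real.exp (-1) = 1 := by rw [← Real.exp_add]; simp
    have h3 : 0 < Real.exp (-1) := Real.exp_pos _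
    nlinarith
  generalize (1359/500) * Real.exp (-1) = r at *
  generalize (C * Real.exp 5 / (1359/500)) = D
  have hsum : Summable (fun n : ℕ => D * ((n:ℝ)^1 * r^n)) :=
    geo_sum D r hr0 hr1
  exact tail_gen _ hsum

theorem term_bound (C : ℝ) (hC : 0 < C) (hcard : ∀ k, ((sawF k).card : ℝ) ≤ C * (1359/500)^k) (β : ℝ) (hβ : 1 ≤ β)
    (n : ℕ) (hn5 : 5 ≤ n) : ((Lgn n).card : ℝ) * Real.exp (-β * n) ≤
      Real.exp (-β * 5) * ((C * Real.exp 5 / (1359/500)) * ((n:ℝ)^1 * ((1359/500) * Real.exp (-1))^n)) := by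
  have h1 : ((Lgn n).card : ℝ) ≤ n * (C * (1359/500)^(n-1)) := by
    have : ((Lgn n).card : ℝ) ≤ n * (sawF (n-1)).card := by exact_mod_cast Lgn_card n
    exact this.trans (mul_le_mul_of_nonneg_left (hcard _) (by positivity))
  have h2 : Real.exp (-β * n) ≤ Real.exp (-β * 5) * Real.exp 5 * Real.exp (-1) ^ n := by
    rw [← Real.exp_nat_mul, ← Real.exp_add, ← Real.exp_add]
    refine Real.exp_le_exp.2 ?_
    have : (5:ℝ) ≤ n := by exact_mod_cast hn5
    nlinarith
  refine (mul_le_mul h1 h2 (Real.exp_nonneg _) (by positivity)).trans (le_of_eq ?_)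
  obtain ⟨k, rfl⟩ : ∃ k, n = k + 1 := ⟨n - 1, by omega⟩
  simp only [Nat.add_sub_cancel, mul_pow, pow_one]
  rw [pow_succ (1359/500 : ℝ) k]
  ring

theorem Lgn_sum (β : ℝ) (n : ℕ) :
    ∑ γ ∈ Lgn n, wo β (some γ) = ENNReal.ofReal (((Lgn n).card : ℝ) * Real.exp (-β * n)) := by
  rw [ENNReal.ofReal_mul (by positivity), ENNReal.ofReal_natCast, ← nsmul_eq_mul, ← Finset.sum_const]
  refine Finset.sum_congr rfl fun γ hγ => ?_
  simp only [wo]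
  rw [Lgn_len n γ hγ]

theorem Lg_sum (β : ℝ) (n0 m : ℕ) :
    ∑ γ ∈ Lg n0 m, wo β (some γ) = ∑ n ∈ Finset.Ico n0 (m+1), ENNReal.ofReal (((Lgn n).card : ℝ) * Real.exp (-β * n)) := by
  have hdis : ((Finset.Ico n0 (m+1) : Finset ℕ) : Set ℕ).PairwiseDisjoint Lgn := by
    intro i _ j _ hij
    rw [Function.onFun, Finset.disjoint_left]
    intro γ h1 h2
    exact hij ((Lgn_len i γ h1).symm.trans (Lgn_len j γ h2))
  rw [Lg, Finset.sum_biUnion hdis]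
  exact Finset.sum_congr rfl fun n _ => Lgn_sum β n

theorem large_sum : ∃ n0 : ℕ, 5 ≤ n0 ∧ ∀ β : ℝ, 1 ≤ β → ∀ m,
    ∑ γ ∈ Lg n0 m, wo β (some γ) ≤ ENNReal.ofReal (Real.exp (-β * 5)) := by
  obtain ⟨C, hC, hcard⟩ := sawF_card
  obtain ⟨n0, h5, hn0⟩ := tail_sum C hC
  refine ⟨n0, h5, fun β hβ m => ?_⟩
  rw [Lg_sum, ← ENNReal.ofReal_sum_of_nonneg (fun n _ => by positivity)]
  refine ENNReal.ofReal_le_ofReal ?_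
  refine (Finset.sum_le_sum fun n hn => term_bound C hC hcard β hβ n (h5.trans (Finset.mem_Ico.1 hn).1)).trans ?_
  rw [← Finset.mul_sum]
  exact mul_le_of_le_one_right (Real.exp_nonneg _) (hn0 m)

theorem level_bound : ∃ n0 : ℕ, ∀ β : ℝ, 1 ≤ β → ∀ m,
    wo β none + ∑ γ ∈ Lg n0 m, wo β (some γ) ≤ ENNReal.ofReal (51/100 * Real.exp (-β * 4)) := by
  obtain ⟨n0, _, h⟩ := large_sum
  refine ⟨n0, fun β hβ m => (add_le_add_right (h β hβ m) _).trans ?_⟩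
  rw [wo, ← ENNReal.ofReal_add (Real.exp_nonneg _) (Real.exp_nonneg _)]
  refine ENNReal.ofReal_le_ofReal ?_
  have e6 : Real.exp (-β * 6) = Real.exp (-β) * Real.exp (-β) * Real.exp (-β * 4) := by
    rw [← Real.exp_add, ← Real.exp_add]; ring_nf
  have e5 : Real.exp (-β * 5) = Real.exp (-β) * Real.exp (-β * 4) := by
    rw [← Real.exp_add]; ring_nf
  rw [e6, e5, ← add_mul]
  refine mul_le_mul_of_nonneg_right ?_ (Real.exp_nonneg _)
  have h1 : Real.exp (-β) ≤ Real.exp (-1) := Real.exp_le_exp.2 (by linarith)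
  have h2 := Real.exp_neg_one_lt_d9
  have h3 := Real.exp_pos (-β)
  nlinarith

def bM (K M : ℕ) : ℝ := 4 * ((M + 1 : ℕ) : ℝ) ^ K * (51/100) ^ M

theorem bM_pos (K M) : 0 < bM K M := by unfold bM; positivity

theorem bM_summable (K : ℕ) : Summable (bM K) := by
  have h := summable_pow_mul_geometric_of_norm_lt_one (R := ℝ) K (r := 51/100) (by norm_num)
  have h2 := ((summable_nat_add_iff 1).2 h).mul_left (4 * (100/51))
  refine h2.congr fun M => ?_
  unfold bM
  rw [pow_succ (51/100 : ℝ)]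
  push_cast
  ring

def TM (v : Site) (M : ℕ) : Set Config := {η | (M:ℤ) ≤ η v ∧ (M = 0 ∨ ∃ u ∈ nbrs v, (M:ℤ) ≤ η u)}

theorem TM_bound : ∃ K : ℕ, ∀ β : ℝ, 1 ≤ β → ∀ Λ v M,
    PE β Λ (TM v M) ≤ ENNReal.ofReal (bM K M * Real.exp (-(4 * β * M))) * ZE β Λ 0 := by
  obtain ⟨n0, h⟩ := level_bound
  refine ⟨(4 * n0 + 5) ^ 2, fun β hβ Λ v M => ?_⟩
  rcases Nat.eq_zero_or_pos M with rfl | hM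
  · have h1 : PE β Λ (TM v 0) ≤ 1 * ZE β Λ 0 := by
      rw [one_mul, ← PE_univ]; exact PE_mono β Λ (Set.subset_univ _)
    refine h1.trans (mul_le_mul_left ?_ _)
    rw [← ENNReal.ofReal_one]
    refine ENNReal.ofReal_le_ofReal ?_
    simp [bM]
  · have h1 : PE β Λ (TM v M) ≤ ∑ u ∈ nbrs v, PE β Λ {η | (M:ℤ) ≤ η v ∧ (M:ℤ) ≤ η u} := by
      apply PE_sUnion β Λ (nbrs v) _ (fun u => {η : Config | (M:ℤ) ≤ η v ∧ (M:ℤ) ≤ η u})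
      intro η hη
      rcases hη.2 with h0 | ⟨u, hu, h2⟩
      · omega
      · exact ⟨u, hu, hη.1, h2⟩
    refine h1.trans ((Finset.sum_le_sum (fun u hu => (Q_bound β (by linarith) Λ n0 v u hu M).trans
      (mul_le_mul_left (mul_le_mul_right (pow_le_pow_left' (h β hβ _) M) _) _))).trans ?_)
    rw [Finset.sum_const, nbrs_card, nsmul_eq_mul, ← mul_assoc]
    refine mul_le_mul_left (le_of_eq ?_) _
    rw [← ENNReal.ofReal_natCast, ← ENNReal.ofReal_natCast, ← ENNReal.ofReal_pow (by positivity), ← ENNReal.ofReal_pow (by positivity),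
      ← ENNReal.ofReal_mul (by positivity), ← ENNReal.ofReal_mul (by positivity)]
    congr 1
    rw [mul_pow, ← Real.exp_nat_mul, bM]
    have : (M:ℝ) * (-β * 4) = -(4 * β * M) := by ring
    rw [this]; push_cast; ring

def AM (v : Site) (h M : ℕ) : Set Config :=
  {η | (h:ℤ) ≤ η v ∧ (M = h ∨ ∀ u ∈ nbrs v, η u ≤ M) ∧ (M = 0 ∨ ∃ u ∈ nbrs v, (M:ℤ) ≤ η u)}

theorem AM_cover (v : Site) (h : ℕ) (η : Config) (hη : (h:ℤ) ≤ η v) : ∃ M ∈ Finset.range (h+1), η ∈ AM v h M := by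
  by_cases hex : ∃ u ∈ nbrs v, (h:ℤ) ≤ η u
  · exact ⟨h, Finset.mem_range.2 (by omega), hη, Or.inl rfl, Or.inr hex⟩
  · push Not at hex
    set m := (nbrs v).sup (fun u => (η u).toNat) with hm
    have hle : ∀ u ∈ nbrs v, (η u).toNat ≤ m := fun u hu => Finset.le_sup (f := fun u => (η u).toNat) hu
    have hmh : m ≤ h := Finset.sup_le fun u hu => by have := hex u hu; omega
    refine ⟨m, Finset.mem_range.2 (by omega), hη, Or.inr fun u hu => by have := hle u hu; omega, ?_⟩
    by_cases h0 : m = 0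
    · exact Or.inl h0
    · right
      by_contra hc
      push Not at hc
      have : m ≤ m - 1 := by
        conv_lhs => rw [hm]
        exact Finset.sup_le fun u hu => by have := hc u hu; omega
      omega

theorem AM_bound (β : ℝ) (hβ : 0 < β) (Λ : Finset Site) (v : Site) (hv : v ∈ Λ) (h M : ℕ) (hM : M ≤ h) :
    PE β Λ (AM v h M) ≤ ENNReal.ofReal (Real.exp (-(4 * β * ((h:ℝ) - M)))) * PE β Λ (TM v M) := by
  refine PE_shift_in β Λ (fun x => if x = v then ((h:ℤ) - M) else 0) ?_ _ _ _ ?_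
  · intro x hx
    have : x ≠ v := fun e => hx (e ▸ hv)
    simp [this]
  · intro g hg
    generalize extendC Λ 0 g = η at hg ⊢
    obtain ⟨h1, h2, h3⟩ := hg
    constructor
    · refine ⟨?_, ?_⟩
      · simp only [Pi.sub_apply, if_true]; omega
      · rcases h3 with h3 | ⟨u, hu, h3⟩
        · exact Or.inl h3
        · refine Or.inr ⟨u, hu, ?_⟩
          have : u ≠ v := (nbrs_ne v u hu).symm
          simp only [Pi.sub_apply, this, if_false]; omega
    · have e : -(4 * β * ((h:ℝ) - M)) = -β * (4 * (((h:ℤ) - (M:ℤ) : ℤ) : ℝ)) := by push_cast; ring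
      rw [e]
      refine wt_le β hβ Λ _ _ _ ?_
      rw [← sum_single Λ v hv]
      refine en_add_le Λ _ _ (fun x _ => if x = v then (((h:ℤ) - (M:ℤ) : ℤ) : ℝ) else 0) ?_ ?_
      · intro x _ hx
        have : x ≠ v := fun e => hx (e ▸ hv)
        simp [this]
      · intro x _ y hy
        have hxy := nbrs_ne x y hy
        by_cases hx : x = v
        · subst hx
          have hz : ¬ (y = x) := fun e => hxy e.symm
          simp only [Pi.sub_apply, if_true, hz, if_false, add_zero, sub_zero]
          norm_cast
          rcases h2 with rfl | h2
          · simp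
          · have := h2 y hy
            rw [abs_of_nonneg (by omega), abs_of_nonneg (by omega)]; omega
        · by_cases hyv : y = v
          · subst hyv
            simp only [Pi.sub_apply, if_true, hx, if_false, zero_add, sub_zero]
            norm_cast
            rcases h2 with rfl | h2
            · simp
            · have := h2 x (nbrs_symm x y hy)
              rw [abs_of_nonpos (by omega), abs_of_nonpos (by omega)]; omega
          · simp [hx, hyv]

theorem upper_bound : ∃ c : ℝ, 0 < c ∧ ∀ β : ℝ, 1 ≤ β → ∀ (Λ : Finset Site) (v : Site), v ∈ Λ → ∀ h : ℕ,
    PE β Λ {η | (h:ℤ) ≤ η v} ≤ ENNReal.ofReal (c * Real.exp (-(4 * β * h))) * ZE β Λ 0 := by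
  obtain ⟨K, hK⟩ := TM_bound
  refine ⟨∑' M, bM K M, (bM_summable K).tsum_pos (fun M => (bM_pos K M).le) 0 (bM_pos K 0), ?_⟩
  intro β hβ Λ v hv h
  have h1 : PE β Λ {η | (h:ℤ) ≤ η v} ≤ ∑ M ∈ Finset.range (h+1), PE β Λ (AM v h M) := by
    apply PE_sUnion β Λ (Finset.range (h+1)) _ (fun M => AM v h M)
    intro η hη
    exact AM_cover v h η hη
  have h2 : ∀ M ∈ Finset.range (h+1), PE β Λ (AM v h M) ≤ ENNReal.ofReal (bM K M * Real.exp (-(4 * β * h))) * ZE β Λ 0 := by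
    intro M hM
    rw [Finset.mem_range] at hM
    refine (AM_bound β (by linarith) Λ v hv h M (by omega)).trans ((mul_le_mul_right (hK β hβ Λ v M) _).trans ?_)
    rw [← mul_assoc, ← ENNReal.ofReal_mul (Real.exp_nonneg _), mul_left_comm, ← Real.exp_add]
    refine mul_le_mul_left (ENNReal.ofReal_le_ofReal (le_of_eq ?_)) _
    ring_nf
  refine h1.trans ((Finset.sum_le_sum h2).trans ?_)
  rw [← Finset.sum_mul, ← ENNReal.ofReal_sum_of_nonneg (fun M _ => mul_nonneg (bM_pos K M).le (Real.exp_nonneg _)), ← Finset.sum_mul]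
  refine mul_le_mul_left (ENNReal.ofReal_le_ofReal (mul_le_mul_of_nonneg_right ?_ (Real.exp_nonneg _))) _
  exact (bM_summable K).sum_le_tsum _ (fun M _ => (bM_pos K M).le)

theorem sos_nofloor_height_bounds :
    ∃ c : ℝ, 0 < c ∧ ∀ β : ℝ, 1 ≤ β → ∀ Λ : Finset Site, ∀ v ∈ Λ, ∀ h : ℕ,
      (1 / 2 : ℝ) * Real.exp (-(4 * β * h)) ≤
          gProb β Λ 0 Set.univ (fun _ => 0) {η | (h : ℤ) ≤ η v} ∧
        gProb β Λ 0 Set.univ (fun _ => 0) {η | (h : ℤ) ≤ η v} ≤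
          c * Real.exp (-(4 * β * h)) := by
  obtain ⟨c, hc, hu⟩ := upper_bound
  refine ⟨c, hc, fun β hβ Λ v hv h => ?_⟩
  have hβ0 : 0 < β := by linarith
  rw [gProb_eq]
  have hZt := ZE_lt_top β hβ0 Λ
  have hZ0 : 0 < (ZE β Λ 0).toReal := ENNReal.toReal_pos (ZE_pos β Λ 0).ne' hZt.ne
  have hPt : PE β Λ {η | (h : ℤ) ≤ η v} < ⊤ :=
    lt_of_le_of_lt ((PE_mono β Λ (Set.subset_univ _)).trans (PE_univ β Λ).le) hZt
  have hl := lower_bound β hβ0 Λ v hv h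
  have hu := hu β hβ Λ v hv h
  generalize PE β Λ {η | (h : ℤ) ≤ η v} = P at hPt hl hu ⊢
  constructor
  · rw [le_div_iff₀ hZ0]
    have := ENNReal.toReal_mono (ENNReal.mul_ne_top (ENNReal.mul_ne_top (by simp) ENNReal.ofReal_ne_top) hPt.ne) hl
    rw [ENNReal.toReal_mul, ENNReal.toReal_mul, ENNReal.toReal_ofReal (Real.exp_nonneg _)] at this
    have e : Real.exp (-(4 * β * h)) * Real.exp (4 * β * h) = 1 := by rw [← Real.exp_add]; simp
    have h3 := mul_le_mul_of_nonneg_left this (Real.exp_nonneg (-(4 * β * h)))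
    have h4 : Real.exp (-(4 * β * h)) * ((2:ENNReal).toReal * Real.exp (4 * β * h) * P.toReal) = 2 * P.toReal := by
      rw [ENNReal.toReal_ofNat]
      linear_combination 2 * P.toReal * e
    rw [h4] at h3
    linarith
  · rw [div_le_iff₀ hZ0]
    have := ENNReal.toReal_mono (ENNReal.mul_ne_top ENNReal.ofReal_ne_top hZt.ne) hu
    rwa [ENNReal.toReal_mul, ENNReal.toReal_ofReal (by positivity)] at this

end SOSPaper
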